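/- arXiv:math/9406215 — 2 statements merged into one kernel-verified Lean document; each statement's English description precedes it below -/
import Mathlib

section
/- (Enflo) The spaces L_1 = L_1([0,1]) and ℓ_1 are not uniformly homeomorphic: there is no bijection f : L_1 → ℓ_1 such that both f and f⁻¹ are uniformly continuous. -/
open MeasureTheory

open Filter Topology

/-- A uniformly continuous map between normed spaces is Lipschitz at large distances. -/
lemma UniformContinuous.exists_norm_sub_le_mul_add_one {X Y : Type*} [NormedAddCommGroup X]
    [NormedSpace ℝ X] [NormedAddCommGroup Y] {g : X → Y} (hg : UniformContinuous g) :
    ∃ K : ℝ, 1 ≤ K ∧ ∀ a b, ‖g a - g b‖ ≤ K * (‖a - b‖ + 1) := by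
  obtain ⟨δ, hδ, hgδ⟩ := Metric.uniformContinuous_iff.1 hg 1 one_pos
  have chain : ∀ n : ℕ, ∀ a b, ‖a - b‖ ≤ n * (δ / 2) → ‖g a - g b‖ ≤ n := by
    intro n
    induction n with
    | zero =>
      intro a b h
      have : a - b = 0 := by simpa using h
      simp [sub_eq_zero.1 this]
    | succ n ih =>
      intro a b h
      have hn : (0 : ℝ) < n + 1 := by positivity
      push_cast at h ⊢
      set c : X := b + ((n : ℝ) / (n + 1)) • (a - b) with hc
      have h1 : c - b = ((n : ℝ) / (n + 1)) • (a - b) := by rw [hc]; abel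
      have h2 : a - c = ((1 : ℝ) / (n + 1)) • (a - b) := by
        have : (1 : ℝ) / (n + 1) = 1 - n / (n + 1) := by field_simp; ring
        rw [this, sub_smul, one_smul, hc]; abel
      have h3 : ‖c - b‖ ≤ n * (δ / 2) := by
        rw [h1, norm_smul, Real.norm_of_nonneg (by positivity), div_mul_eq_mul_div,
          div_le_iff₀ hn]
        nlinarith [mul_le_mul_of_nonneg_left h n.cast_nonneg]
      have h4 : ‖a - c‖ < δ := by
        rw [h2, norm_smul, Real.norm_of_nonneg (by positivity), div_mul_eq_mul_div,
          div_lt_iff₀ hn]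
        nlinarith
      have h5 := hgδ (a := a) (b := c) (by rwa [dist_eq_norm])
      rw [dist_eq_norm] at h5
      linarith [norm_sub_le_norm_sub_add_norm_sub (g a) (g c) (g b), ih c b h3]
  refine ⟨2 / δ + 1, by linarith [div_pos two_pos hδ], fun a b => ?_⟩
  have h1 := chain ⌈‖a - b‖ / (δ / 2)⌉₊ a b (by
    rw [← div_le_iff₀ (by positivity)]; exact Nat.le_ceil _)
  have h2 := Nat.ceil_lt_add_one (a := ‖a - b‖ / (δ / 2)) (by positivity)
  have h3 : ‖a - b‖ / (δ / 2) = 2 / δ * ‖a - b‖ := by field_simp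
  have h4 : 0 < 2 / δ := by positivity
  nlinarith [norm_nonneg (a - b)]

lemma lp.summable_abs (u : lp (fun _ : ℕ => ℝ) 1) : Summable fun i => |u i| := by
  simpa using (lp.hasSum_norm (p := 1) (by simp) u).summable

lemma lp.norm_eq_sum_range_add_tsum (u : lp (fun _ : ℕ => ℝ) 1) (N : ℕ) :
    ‖u‖ = ∑ i ∈ Finset.range N, |u i| + ∑' i, |u (i + N)| := by
  rw [(lp.summable_abs u).sum_add_tsum_nat_add N]
  simpa using (lp.hasSum_norm (p := 1) (by simp) u).tsum_eq.symm

/-- A bounded sequence in `ℓ¹` has two terms which are close on the first `N` coordinates. -/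
lemma lp.exists_ne_sum_range_abs_sub_le (z : ℕ → lp (fun _ : ℕ => ℝ) 1) {R : ℝ}
    (hz : ∀ j, ‖z j‖ ≤ R) (N : ℕ) {η : ℝ} (hη : 0 < η) :
    ∃ j k, j ≠ k ∧ ∑ i ∈ Finset.range N, |z j i - z k i| ≤ η := by
  let P : ℕ → Fin N → ℝ := fun j i => z j i
  have hP : ∀ j, P j ∈ Metric.closedBall (0 : Fin N → ℝ) R := by
    intro j
    rw [mem_closedBall_zero_iff, pi_norm_le_iff_of_nonneg ((norm_nonneg _).trans (hz j))]
    exact fun i => (lp.norm_apply_le_norm (by simp) (z j) i).trans (hz j)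
  obtain ⟨p, -, φ, hφ, hlim⟩ := (isCompact_closedBall (0 : Fin N → ℝ) R).tendsto_subseq hP
  obtain ⟨M, hM⟩ := Metric.cauchySeq_iff'.1 hlim.cauchySeq (η / (N + 1)) (by positivity)
  have hd := hM (M + 1) (by omega)
  refine ⟨φ (M + 1), φ M, hφ.injective.ne (by omega), ?_⟩
  calc ∑ i ∈ Finset.range N, |z (φ (M + 1)) i - z (φ M) i|
      ≤ ∑ i ∈ Finset.range N, η / (N + 1) := by
        refine Finset.sum_le_sum fun i hi => ?_
        have := dist_le_pi_dist ((P ∘ φ) (M + 1)) ((P ∘ φ) M) ⟨i, Finset.mem_range.1 hi⟩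
        exact this.trans hd.le
    _ ≤ η := by
        rw [Finset.sum_const, Finset.card_range, nsmul_eq_mul, mul_div_assoc', div_le_iff₀
          (by positivity)]
        nlinarith

/-- The tail of an approximate metric midpoint of `u` and `v` in `ℓ¹` is small. -/
lemma lp.tsum_tail_le_of_approx_midpoint (u v z : lp (fun _ : ℕ => ℝ) 1) (N : ℕ) {δ η : ℝ}
    (hu : ∑' i, |u (i + N)| ≤ η) (hv : ∑' i, |v (i + N)| ≤ η)
    (hzu : ‖z - u‖ ≤ (1 + δ) / 2 * ‖u - v‖) (hzv : ‖z - v‖ ≤ (1 + δ) / 2 * ‖u - v‖) :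
    ∑' i, |z (i + N)| ≤ δ / 2 * ‖u - v‖ + 2 * η := by
  have hs (w : lp (fun _ : ℕ => ℝ) 1) : Summable fun i => |w (i + N)| :=
    (summable_nat_add_iff N).2 (lp.summable_abs w)
  have head : ∑ i ∈ Finset.range N, |(u - v) i| ≤
      ∑ i ∈ Finset.range N, |(z - u) i| + ∑ i ∈ Finset.range N, |(z - v) i| := by
    rw [← Finset.sum_add_distrib]
    refine Finset.sum_le_sum fun i _ => ?_
    simp only [lp.coeFn_sub, Pi.sub_apply]
    rw [abs_sub_comm (z i) (u i)]
    exact abs_sub_le _ _ _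
  have tail (w : lp (fun _ : ℕ => ℝ) 1) :
      ∑' i, |z (i + N)| ≤ ∑' i, |(z - w) (i + N)| + ∑' i, |w (i + N)| := by
    rw [← (hs _).tsum_add (hs _)]
    refine (hs z).tsum_le_tsum (fun i => ?_) ((hs _).add (hs _))
    simpa using abs_add_le (z (i + N) - w (i + N)) (w (i + N))
  have tail' : ∑' i, |(u - v) (i + N)| ≤ ∑' i, |u (i + N)| + ∑' i, |v (i + N)| := by
    rw [← (hs _).tsum_add (hs _)]
    refine (hs _).tsum_le_tsum (fun i => ?_) ((hs _).add (hs _))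
    simpa using abs_sub (u (i + N)) (v (i + N))
  have e1 := lp.norm_eq_sum_range_add_tsum (z - u) N
  have e2 := lp.norm_eq_sum_range_add_tsum (z - v) N
  have e3 := lp.norm_eq_sum_range_add_tsum (u - v) N
  linarith [tail u, tail v]

/-- Any sequence of approximate metric midpoints in `ℓ¹` has two terms close to each other. -/
lemma lp.exists_ne_norm_sub_le_of_approx_midpoints {u v : lp (fun _ : ℕ => ℝ) 1} (huv : u ≠ v)
    {δ : ℝ} (hδ : 0 < δ) (z : ℕ → lp (fun _ : ℕ => ℝ) 1)
    (hzu : ∀ j, ‖z j - u‖ ≤ (1 + δ) / 2 * ‖u - v‖)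
    (hzv : ∀ j, ‖z j - v‖ ≤ (1 + δ) / 2 * ‖u - v‖) :
    ∃ j k, j ≠ k ∧ ‖z j - z k‖ ≤ 2 * δ * ‖u - v‖ := by
  have hD : 0 < ‖u - v‖ := norm_pos_iff.2 (sub_ne_zero.2 huv)
  have hη : 0 < δ * ‖u - v‖ / 5 := by positivity
  obtain ⟨N, hu, hv⟩ := (((tendsto_sum_nat_add fun i => |u i|).eventually_le_const hη).and
    ((tendsto_sum_nat_add fun i => |v i|).eventually_le_const hη)).exists
  obtain ⟨j, k, hjk, hhead⟩ := lp.exists_ne_sum_range_abs_sub_le z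
    (R := (1 + δ) / 2 * ‖u - v‖ + ‖u‖)
    (fun j => by linarith [hzu j, norm_le_norm_sub_add (z j) u]) N hη
  refine ⟨j, k, hjk, ?_⟩
  have hs (w : lp (fun _ : ℕ => ℝ) 1) : Summable fun i => |w (i + N)| :=
    (summable_nat_add_iff N).2 (lp.summable_abs w)
  have tail : ∑' i, |(z j - z k) (i + N)| ≤ ∑' i, |z j (i + N)| + ∑' i, |z k (i + N)| := by
    rw [← (hs _).tsum_add (hs _)]
    refine (hs _).tsum_le_tsum (fun i => ?_) ((hs _).add (hs _))
    simpa using abs_sub (z j (i + N)) (z k (i + N))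
  have t1 := lp.tsum_tail_le_of_approx_midpoint u v (z j) N hu hv (hzu j) (hzv j)
  have t2 := lp.tsum_tail_le_of_approx_midpoint u v (z k) N hu hv (hzu k) (hzv k)
  rw [lp.norm_eq_sum_range_add_tsum _ N]
  have : ∑ i ∈ Finset.range N, |(z j - z k) i| ≤ δ * ‖u - v‖ / 5 := hhead
  linarith

/-- Riemann–Lebesgue lemma for cosines with integer frequencies. -/
lemma tendsto_integral_cos_mul_atTop {s : Set ℝ} (hs : MeasurableSet s) {g : ℝ → ℝ}
    (hg : Integrable g (volume.restrict s)) :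
    Tendsto (fun n : ℕ => ∫ t in s, Real.cos (2 * Real.pi * n * t) * g t) atTop (𝓝 0) := by
  have h1 := (Real.tendsto_integral_exp_smul_cocompact
    (fun t => ((s.indicator g t : ℝ) : ℂ))).comp
    (tendsto_natCast_atTop_atTop.mono_right atTop_le_cocompact :
      Tendsto (fun n : ℕ => (n : ℝ)) atTop (cocompact ℝ))
  have h2 := (Complex.continuous_re.tendsto 0).comp h1
  rw [Complex.zero_re] at h2
  refine h2.congr fun n => ?_
  have hint : Integrable fun t => ((s.indicator g t : ℝ) : ℂ) :=
    ((integrable_indicator_iff hs).2 hg).ofReal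
  have hint' := (Real.fourierIntegral_convergent_iff (μ := volume) (n : ℝ)).2 hint
  simp only [Real.inner_apply] at hint'
  calc (∫ t : ℝ, Real.fourierChar (-(t * n)) • ((s.indicator g t : ℝ) : ℂ)).re
      = ∫ t : ℝ, (Real.fourierChar (-(t * n)) • ((s.indicator g t : ℝ) : ℂ)).re :=
        (integral_re hint').symm
    _ = ∫ t, s.indicator (fun t => Real.cos (2 * Real.pi * n * t) * g t) t := by
        refine integral_congr_ae (.of_forall fun t => ?_)
        simp only [Circle.smul_def, Real.fourierChar_apply, smul_eq_mul, Complex.re_mul_ofReal,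
          Complex.exp_ofReal_mul_I_re]
        by_cases ht : t ∈ s
        · rw [Set.indicator_of_mem ht, Set.indicator_of_mem ht, ← Real.cos_neg]
          ring_nf
        · rw [Set.indicator_of_notMem ht, Set.indicator_of_notMem ht, mul_zero]
    _ = ∫ t in s, Real.cos (2 * Real.pi * n * t) * g t := integral_indicator hs

/-- In `L¹` of a measure on the line satisfying the Riemann–Lebesgue lemma, distinct points have a
separated sequence of approximate metric midpoints. -/
lemma Lp.exists_separated_approx_midpoints {μ : Measure ℝ}
    (hμ : ∀ g : ℝ → ℝ, Integrable g μ →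
      Tendsto (fun n : ℕ => ∫ t, Real.cos (2 * Real.pi * n * t) * g t ∂μ) atTop (𝓝 0))
    {x y : Lp ℝ 1 μ} (hxy : x ≠ y) {δ : ℝ} (hδ : 0 < δ) :
    ∃ m : ℕ → Lp ℝ 1 μ,
      (∀ j, ‖m j - x‖ ≤ (1 + δ) / 2 * ‖x - y‖) ∧ (∀ j, ‖m j - y‖ ≤ (1 + δ) / 2 * ‖x - y‖) ∧
      ∀ j k, j ≠ k → ‖x - y‖ / 8 ≤ ‖m j - m k‖ := by
  set h : ℝ → ℝ := ⇑(x - y) with hh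
  have hint : Integrable h μ := L1.integrable_coeFn (x - y)
  have hD : 0 < ‖x - y‖ := norm_pos_iff.2 (sub_ne_zero.2 hxy)
  have hDint : ‖x - y‖ = ∫ t, |h t| ∂μ := L1.norm_eq_integral_norm _
  let c : ℕ → ℝ → ℝ := fun n t => Real.cos (2 * Real.pi * n * t)
  have hc : ∀ n t, |c n t| ≤ 1 := fun n t => Real.abs_cos_le_one _
  have hcm : ∀ n, Continuous (c n) := fun n => by fun_prop
  have hcint : ∀ n, ∀ g : ℝ → ℝ, Integrable g μ → Integrable (fun t => c n t * g t) μ :=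
    fun n g hg => hg.bdd_mul (hcm n).aestronglyMeasurable (.of_forall (hc n))
  have hlim := hμ _ hint.abs
  obtain ⟨N, hN⟩ : ∃ N : ℕ, ∀ n ≥ N,
      |∫ t, c n t * |h t| ∂μ| ≤ min δ (1 / 8) * ‖x - y‖ :=
    eventually_atTop.1 (hlim.abs.eventually_le_const (by rw [abs_zero]; positivity))
  have hNδ : ∀ n ≥ N, |∫ t, c n t * |h t| ∂μ| ≤ δ * ‖x - y‖ := fun n hn =>
    (hN n hn).trans (by gcongr; exact min_le_left _ _)
  have hN8 : ∀ n ≥ N, |∫ t, c n t * |h t| ∂μ| ≤ 1 / 8 * ‖x - y‖ := fun n hn =>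
    (hN n hn).trans (by gcongr; exact min_le_right _ _)
  let e : ℕ → Lp ℝ 1 μ := fun n => (hcint n h hint).toL1 _
  have he : ∀ n, e n =ᵐ[μ] fun t => c n t * h t := fun n => Integrable.coeFn_toL1 _
  let m : ℕ → Lp ℝ 1 μ := fun n => (1 / 2 : ℝ) • (x + y + e n)
  have hmx : ∀ n, ‖m n - x‖ = 1 / 2 * (‖x - y‖ - ∫ t, c n t * |h t| ∂μ) := by
    intro n
    have h1 : m n - x = (1 / 2 : ℝ) • (e n - (x - y)) := by
      simp only [m]; module
    rw [h1, norm_smul, L1.norm_eq_integral_norm, hDint,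
      ← integral_sub hint.abs (hcint n _ hint.abs), Real.norm_of_nonneg (by norm_num)]
    congr 1
    refine integral_congr_ae ?_
    filter_upwards [he n, Lp.coeFn_sub (e n) (x - y)] with t h2 h3
    rw [h3, Pi.sub_apply, h2, Real.norm_eq_abs, ← hh,
      show c n t * h t - h t = -((1 - c n t) * h t) by ring, abs_neg, abs_mul,
      abs_of_nonneg (by linarith [le_abs_self (c n t), hc n t])]
    ring
  have hmy : ∀ n, ‖m n - y‖ = 1 / 2 * (‖x - y‖ + ∫ t, c n t * |h t| ∂μ) := by
    intro n
    have h1 : m n - y = (1 / 2 : ℝ) • (e n + (x - y)) := by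
      simp only [m]; module
    rw [h1, norm_smul, L1.norm_eq_integral_norm, hDint,
      ← integral_add hint.abs (hcint n _ hint.abs), Real.norm_of_nonneg (by norm_num)]
    congr 1
    refine integral_congr_ae ?_
    filter_upwards [he n, Lp.coeFn_add (e n) (x - y)] with t h2 h3
    rw [h3, Pi.add_apply, h2, Real.norm_eq_abs, ← hh,
      show c n t * h t + h t = (1 + c n t) * h t by ring, abs_mul,
      abs_of_nonneg (by linarith [neg_abs_le (c n t), hc n t])]
    ring
  have hsep : ∀ k d, N ≤ k → N ≤ d → ‖x - y‖ / 8 ≤ ‖m (k + d) - m k‖ := by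
    intro k d hk hd
    have h1 : m (k + d) - m k = (1 / 2 : ℝ) • (e (k + d) - e k) := by
      simp only [m]; module
    have hp : ∀ t, 1 + 1 / 2 * c (2 * (k + d)) t + 1 / 2 * c (2 * k) t - c (2 * k + d) t - c d t
        = (c (k + d) t - c k t) ^ 2 := by
      intro t
      have e1 : c (2 * (k + d)) t = 2 * c (k + d) t ^ 2 - 1 := by
        simp only [c]; rw [← Real.cos_two_mul]; push_cast; ring_nf
      have e2 : c (2 * k) t = 2 * c k t ^ 2 - 1 := by
        simp only [c]; rw [← Real.cos_two_mul]; push_cast; ring_nf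
      have e3 : c (2 * k + d) t + c d t = 2 * c (k + d) t * c k t := by
        simp only [c]
        rw [Real.two_mul_cos_mul_cos, add_comm]
        push_cast; ring_nf
      linear_combination 1 / 2 * e1 + 1 / 2 * e2 - e3
    have hnorm : ‖m (k + d) - m k‖ = ∫ t, 1 / 2 * (|c (k + d) t - c k t| * |h t|) ∂μ := by
      rw [h1, norm_smul, L1.norm_eq_integral_norm, Real.norm_of_nonneg (by norm_num),
        integral_const_mul]
      congr 1
      refine integral_congr_ae ?_
      filter_upwards [he (k + d), he k, Lp.coeFn_sub (e (k + d)) (e k)] with t h2 h3 h4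
      rw [h4, Pi.sub_apply, h2, h3, Real.norm_eq_abs, ← sub_mul, abs_mul]
    have hI (n : ℕ) := hcint n _ hint.abs
    have g₁ := (hI (2 * (k + d))).const_mul (1 / 2)
    have g₂ := (hI (2 * k)).const_mul (1 / 2)
    have g₃ := hint.abs.add g₁
    have g₄ := g₃.add g₂
    have g₅ := g₄.sub (hI (2 * k + d))
    have g₆ := g₅.sub (hI d)
    have hlow : 1 / 4 * (‖x - y‖ + 1 / 2 * (∫ t, c (2 * (k + d)) t * |h t| ∂μ)
        + 1 / 2 * (∫ t, c (2 * k) t * |h t| ∂μ) - (∫ t, c (2 * k + d) t * |h t| ∂μ)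
        - ∫ t, c d t * |h t| ∂μ) ≤ ‖m (k + d) - m k‖ := by
      rw [hnorm, hDint, ← integral_const_mul, ← integral_const_mul, ← integral_add' hint.abs g₁,
        ← integral_add' g₃ g₂, ← integral_sub' g₄ (hI _), ← integral_sub' g₅ (hI _),
        ← integral_const_mul]
      refine integral_mono (g₆.const_mul _) ?_ fun t => ?_
      · refine Integrable.const_mul ?_ _
        refine ((hcint (k + d) h hint).sub (hcint k h hint)).abs.congr (.of_forall fun t => ?_)
        simp only [Pi.sub_apply]
        rw [← sub_mul, abs_mul]
      · simp only [Pi.add_apply, Pi.sub_apply]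
        have hq : (c (k + d) t - c k t) ^ 2 ≤ 2 * |c (k + d) t - c k t| := by
          rw [← sq_abs]
          nlinarith [abs_nonneg (c (k + d) t - c k t), abs_sub (c (k + d) t) (c k t),
            hc (k + d) t, hc k t]
        have := mul_le_mul_of_nonneg_right hq (abs_nonneg (h t))
        rw [← hp t] at this
        linarith
    have b1 := abs_le.1 (hN8 (2 * (k + d)) (by omega))
    have b2 := abs_le.1 (hN8 (2 * k) (by omega))
    have b3 := abs_le.1 (hN8 (2 * k + d) (by omega))
    have b4 := abs_le.1 (hN8 d hd)
    linarith
  have hlt : ∀ j k : ℕ, k < j → ‖x - y‖ / 8 ≤ ‖m (N * (j + 1)) - m (N * (k + 1))‖ := by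
    intro j k hjk
    obtain ⟨d, rfl⟩ := Nat.exists_eq_add_of_lt hjk
    have := hsep (N * (k + 1)) (N * (d + 1)) (Nat.le_mul_of_pos_right _ (by omega))
      (Nat.le_mul_of_pos_right _ (by omega))
    rwa [← mul_add, show k + 1 + (d + 1) = k + d + 1 + 1 by ring] at this
  have hge (j : ℕ) : N * (j + 1) ≥ N := Nat.le_mul_of_pos_right _ (by omega)
  refine ⟨fun j => m (N * (j + 1)), fun j => ?_, fun j => ?_, fun j k hjk => ?_⟩
  · simp only [hmx]; linarith [(abs_le.1 (hNδ _ (hge j))).1]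
  · simp only [hmy]; linarith [(abs_le.1 (hNδ _ (hge j))).2]
  · rcases hjk.lt_or_gt with h | h
    · exact (hlt k j h).trans_eq (norm_sub_rev _ _)
    · exact hlt j k h

/-- For a map which is Lipschitz at large distances and does not contract too much, the asymptotic
Lipschitz constant is positive and almost attained at arbitrarily large distances. -/
lemma exists_asymptotic_lipschitz_constant {X Y : Type*} [NormedAddCommGroup X] [NormedSpace ℝ X]
    [Nontrivial X] [NormedAddCommGroup Y] {f : X → Y} {K : ℝ} (hK : 1 ≤ K)
    (hf : ∀ a b, ‖f a - f b‖ ≤ K * (‖a - b‖ + 1))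
    (hf' : ∀ a b, ‖a - b‖ ≤ K * (‖f a - f b‖ + 1)) :
    ∃ L : ℝ, 0 < L ∧ ∀ δ > 0,
      (∃ s, ∀ a b, s ≤ ‖a - b‖ → ‖f a - f b‖ ≤ L * (1 + δ) * ‖a - b‖) ∧
      ∀ s, ∃ a b, s ≤ ‖a - b‖ ∧ L * (1 - δ) * ‖a - b‖ < ‖f a - f b‖ := by
  let S : Set ℝ := {L | ∃ s, ∀ a b, s ≤ ‖a - b‖ → ‖f a - f b‖ ≤ L * ‖a - b‖}
  have hne : S.Nonempty := ⟨2 * K, 1, fun a b h => (hf a b).trans (by nlinarith)⟩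
  have hlb : ∀ L ∈ S, 1 / (2 * K) ≤ L := by
    rintro L ⟨s, hs⟩
    obtain ⟨a, ha⟩ := NormedSpace.exists_lt_norm ℝ X (max s (2 * K))
    have h1 := hs a 0 (by rw [sub_zero]; exact (le_max_left _ _).trans ha.le)
    have h2 := hf' a 0
    have h3 : 2 * K < ‖a‖ := (le_max_right _ _).trans_lt ha
    rw [sub_zero] at h1 h2
    rw [div_le_iff₀ (by positivity)]
    have h4 : ‖a‖ ≤ K * (L * ‖a‖ + 1) := h2.trans (by gcongr)
    by_contra! h5
    nlinarith
  have hbdd : BddBelow S := ⟨_, hlb⟩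
  have hpos : 0 < sInf S := lt_of_lt_of_le (by positivity) (le_csInf hne hlb)
  refine ⟨sInf S, hpos, fun δ hδ => ⟨?_, fun s => ?_⟩⟩
  · obtain ⟨L, ⟨s, hs⟩, hL⟩ := exists_lt_of_csInf_lt hne
      (show sInf S < sInf S * (1 + δ) by nlinarith)
    exact ⟨s, fun a b h => (hs a b h).trans (by gcongr)⟩
  · by_contra! hcon
    have := csInf_le hbdd (show sInf S * (1 - δ) ∈ S from ⟨s, hcon⟩)
    nlinarith

/-- (Enflo) `L_1([0,1])` and `ℓ_1` are not uniformly homeomorphic. -/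
theorem L1_not_uniformly_homeomorphic_to_l1 :
    ¬ ∃ f : Lp ℝ 1 (volume.restrict (Set.Icc (0:ℝ) 1)) ≃ lp (fun _ : ℕ => ℝ) 1,
        UniformContinuous f ∧ UniformContinuous f.symm := by
  rintro ⟨f, hf, hf'⟩
  obtain ⟨K₁, hK₁, hfK₁⟩ := hf.exists_norm_sub_le_mul_add_one
  obtain ⟨K₂, hK₂, hfK₂⟩ := hf'.exists_norm_sub_le_mul_add_one
  obtain ⟨K, hK, hfK, hfK'⟩ : ∃ K : ℝ, 1 ≤ K ∧ (∀ a b, ‖f a - f b‖ ≤ K * (‖a - b‖ + 1)) ∧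
      ∀ a b, ‖a - b‖ ≤ K * (‖f a - f b‖ + 1) := by
    refine ⟨max K₁ K₂, le_max_of_le_left hK₁, fun a b => (hfK₁ a b).trans ?_, fun a b => ?_⟩
    · gcongr; exact le_max_left _ _
    · have := hfK₂ (f a) (f b)
      rw [f.symm_apply_apply, f.symm_apply_apply] at this
      exact this.trans (by gcongr; exact le_max_right _ _)
  have : Nontrivial (lp (fun _ : ℕ => ℝ) 1) :=
    ⟨lp.single 1 0 1, 0, fun h => one_ne_zero (α := ℝ) (by
      simpa using congrArg (fun u : lp (fun _ : ℕ => ℝ) 1 => u 0) h)⟩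
  have : Nontrivial (Lp ℝ 1 (volume.restrict (Set.Icc (0:ℝ) 1))) := f.nontrivial
  obtain ⟨L, hL, hLδ⟩ := exists_asymptotic_lipschitz_constant hK hfK hfK'
  obtain ⟨δ, hδ, hδ4, hδK⟩ : ∃ δ : ℝ, 0 < δ ∧ δ ≤ 1 / 4 ∧ K * (20 * δ * L) ≤ 1 / 16 := by
    refine ⟨min (1 / 4) (1 / (320 * K * L)), by positivity, min_le_left _ _, ?_⟩
    calc K * (20 * min (1 / 4) (1 / (320 * K * L)) * L)
        ≤ K * (20 * (1 / (320 * K * L)) * L) := by gcongr; exact min_le_right _ _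
      _ = 1 / 16 := by field_simp; norm_num
  obtain ⟨⟨s, hs⟩, hlarge⟩ := hLδ δ hδ
  obtain ⟨x, y, hxy, hlow⟩ := hlarge (max (4 * s) (17 * K))
  have hd1 : 4 * s ≤ ‖x - y‖ := (le_max_left _ _).trans hxy
  have hd2 : 17 * K ≤ ‖x - y‖ := (le_max_right _ _).trans hxy
  have hd : 0 < ‖x - y‖ := by linarith
  have hne : x ≠ y := sub_ne_zero.1 (norm_pos_iff.1 hd)
  obtain ⟨m, hmx, hmy, hsep⟩ := Lp.exists_separated_approx_midpoints
    (fun _ => tendsto_integral_cos_mul_atTop measurableSet_Icc) hne hδ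
  have key : ∀ a b : Lp ℝ 1 (volume.restrict (Set.Icc (0:ℝ) 1)), s ≤ ‖a - b‖ →
      ‖a - b‖ ≤ (1 + δ) / 2 * ‖x - y‖ → ‖f a - f b‖ ≤ (1 + 8 * δ) / 2 * ‖f x - f y‖ := by
    intro a b h1 h2
    calc ‖f a - f b‖ ≤ L * (1 + δ) * ‖a - b‖ := hs a b h1
      _ ≤ L * (1 + δ) * ((1 + δ) / 2 * ‖x - y‖) := by gcongr
      _ = (1 + δ) ^ 2 / 2 * (L * ‖x - y‖) := by ring
      _ ≤ (1 + 8 * δ) * (1 - δ) / 2 * (L * ‖x - y‖) := by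
        gcongr ?_ / 2 * _
        nlinarith
      _ = (1 + 8 * δ) / 2 * (L * (1 - δ) * ‖x - y‖) := by ring
      _ ≤ (1 + 8 * δ) / 2 * ‖f x - f y‖ := by gcongr
  have hup := hs x y (by linarith [hd])
  obtain ⟨j, k, hjk, hclose⟩ := lp.exists_ne_norm_sub_le_of_approx_midpoints
    (f.injective.ne hne) (δ := 8 * δ) (by positivity) (fun j => f (m j))
    (fun j => key _ _ (by
      nlinarith [hmy j, norm_sub_le_norm_sub_add_norm_sub x (m j) y, norm_sub_rev x (m j)]) (hmx j))
    (fun j => key _ _ (by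
      nlinarith [hmx j, norm_sub_le_norm_sub_add_norm_sub x (m j) y, norm_sub_rev x (m j)]) (hmy j))
  have h1 := hfK' (m j) (m k)
  have h2 := hsep j k hjk
  have h3 : ‖f (m j) - f (m k)‖ ≤ 20 * δ * L * ‖x - y‖ := by
    calc ‖f (m j) - f (m k)‖ ≤ 2 * (8 * δ) * ‖f x - f y‖ := hclose
      _ ≤ 2 * (8 * δ) * (L * (1 + δ) * ‖x - y‖) := by gcongr
      _ ≤ 2 * (8 * δ) * (L * (5 / 4) * ‖x - y‖) := by gcongr; linarith
      _ = 20 * δ * L * ‖x - y‖ := by ring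
  have h4 : ‖m j - m k‖ ≤ K * (20 * δ * L) * ‖x - y‖ + K := by
    refine h1.trans ?_
    have := mul_le_mul_of_nonneg_left h3 (show 0 ≤ K by linarith)
    linarith
  have h5 := mul_le_mul_of_nonneg_right hδK hd.le
  linarith
end

section
/- (Ribe, Aharoni–Lindenstrauss) Let 1 ≤ p, q < ∞ and let (p_n) be a sequence with 1 ≤ p_n < ∞ and p_n → p. Let X_n = ℓ_{p_n} = lp (fun _ : ℕ => ℝ) (p_n), and let S = (Σ ⊕ ℓ_{p_n})_q be the q-direct sum lp (fun n => X_n) q. Then S is uniformly homeomorphic to ℓ_p ⊕_q S, the product ℓ_p × S equipped with the q-norm (‖x‖^q + ‖s‖^q)^{1/q}: there is a bijection f : WithLp q (ℓ_p × S) → S with f and f⁻¹ both uniformly continuous. -/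
open Filter Topology

namespace RibeUniform

open scoped ENNReal

theorem summable_and_tsum_rpow_mul_rpow_le {U V : ℕ → ℝ} (hU : ∀ i, 0 ≤ U i) (hV : ∀ i, 0 ≤ V i)
    (sU : Summable U) (sV : Summable V) {l : ℝ} (hl0 : 0 ≤ l) (hl1 : l ≤ 1) :
    Summable (fun i => U i ^ l * V i ^ (1 - l)) ∧
      ∑' i, U i ^ l * V i ^ (1 - l) ≤ (∑' i, U i) ^ l * (∑' i, V i) ^ (1 - l) := by
  rcases hl0.eq_or_lt with rfl | h0
  · simpa using sV
  rcases hl1.eq_or_lt with rfl | h1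
  · simpa using sU
  have h1' : 0 < 1 - l := by linarith
  have hc : (1 / l).HolderConjugate (1 / (1 - l)) := by
    rw [Real.holderConjugate_iff]
    refine ⟨by rw [lt_div_iff₀ h0]; linarith, by simp⟩
  have e1 : ∀ i, (U i ^ l) ^ (1 / l) = U i := fun i => by
    rw [← Real.rpow_mul (hU i), mul_one_div_cancel h0.ne', Real.rpow_one]
  have e2 : ∀ i, (V i ^ (1 - l)) ^ (1 / (1 - l)) = V i := fun i => by
    rw [← Real.rpow_mul (hV i), mul_one_div_cancel h1'.ne', Real.rpow_one]
  have := Real.summable_and_inner_le_Lp_mul_Lq_tsum_of_nonneg hc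
    (f := fun i => U i ^ l) (g := fun i => V i ^ (1 - l))
    (fun i => Real.rpow_nonneg (hU i) _) (fun i => Real.rpow_nonneg (hV i) _)
    (by simpa only [e1] using sU) (by simpa only [e2] using sV)
  simpa only [e1, e2, one_div_one_div] using this

theorem exists_lp_norm_le_rpow_mul_rpow {r s : ℝ≥0∞} [Fact (1 ≤ r)] (hr : 0 < r.toReal)
    (hs : 0 < s.toReal) {E : ℕ → Type*} [∀ k, NormedAddCommGroup (E k)] {a θ C : ℝ} (ha : a * s.toReal = r.toReal)
    (hθ0 : 0 ≤ θ) (hθa : θ ≤ a) (hC : 0 ≤ C) {F P : lp (fun _ : ℕ => ℝ) r}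
    (hF : ∀ k, 0 ≤ F k) (hP : ∀ k, 0 ≤ P k) {b : ∀ k, E k}
    (hb : ∀ k, ‖b k‖ ≤ C * F k ^ θ * P k ^ (a - θ)) :
    ∃ g : lp E s, (∀ k, g k = b k) ∧ ‖g‖ ≤ C * ‖F‖ ^ θ * ‖P‖ ^ (a - θ) := by
  have ha0 : 0 < a := by
    by_contra h
    have := mul_nonpos_of_nonpos_of_nonneg (not_lt.1 h) hs.le
    linarith
  have e : ∀ x y : ℝ, 0 ≤ x → 0 ≤ y → (C * x ^ θ * y ^ (a - θ)) ^ s.toReal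
      = C ^ s.toReal * ((x ^ r.toReal) ^ (θ / a) * (y ^ r.toReal) ^ (1 - θ / a)) := by
    intro x y hx hy
    rw [Real.mul_rpow (by positivity) (by positivity), Real.mul_rpow hC (by positivity),
      ← Real.rpow_mul hx, ← Real.rpow_mul hy, ← Real.rpow_mul hx, ← Real.rpow_mul hy, ← ha,
      mul_assoc]
    congr 3
    · field_simp
    · field_simp
  obtain ⟨hs1, hs2⟩ := summable_and_tsum_rpow_mul_rpow_le (l := θ / a)
    (U := fun k => F k ^ r.toReal) (V := fun k => P k ^ r.toReal)
    (fun k => Real.rpow_nonneg (hF k) _) (fun k => Real.rpow_nonneg (hP k) _)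
    (by simpa [Real.norm_of_nonneg (hF _)] using (lp.memℓp F).summable hr)
    (by simpa [Real.norm_of_nonneg (hP _)] using (lp.memℓp P).summable hr)
    (by positivity) (by rw [div_le_one ha0]; exact hθa)
  have hle : ∀ k, ‖b k‖ ^ s.toReal ≤ C ^ s.toReal *
      ((F k ^ r.toReal) ^ (θ / a) * (P k ^ r.toReal) ^ (1 - θ / a)) := fun k => by
    rw [← e _ _ (hF k) (hP k)]
    exact Real.rpow_le_rpow (norm_nonneg _) (hb k) hs.le
  have hsum : Summable fun k => ‖b k‖ ^ s.toReal :=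
    Summable.of_nonneg_of_le (fun k => by positivity) hle (hs1.mul_left _)
  refine ⟨⟨b, memℓp_gen hsum⟩, fun _ => rfl, lp.norm_le_of_tsum_le hs (by positivity) ?_⟩
  rw [e _ _ (norm_nonneg _) (norm_nonneg _), lp.norm_rpow_eq_tsum hr, lp.norm_rpow_eq_tsum hr]
  simp only [Real.norm_of_nonneg (hF _), Real.norm_of_nonneg (hP _)]
  calc _ ≤ ∑' k, C ^ s.toReal * ((F k ^ r.toReal) ^ (θ / a) * (P k ^ r.toReal) ^ (1 - θ / a)) :=
        hsum.tsum_le_tsum hle (hs1.mul_left _)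
    _ ≤ _ := by rw [tsum_mul_left]; gcongr

theorem exists_lp_norm_le {q : ℝ≥0∞} [Fact (1 ≤ q)] (hq : 0 < q.toReal)
    {E : ℕ → Type*} [∀ k, NormedAddCommGroup (E k)] {F : lp (fun _ : ℕ => ℝ) q} {b : ∀ k, E k}
    (hb : ∀ k, ‖b k‖ ≤ F k) :
    ∃ g : lp E q, (∀ k, g k = b k) ∧ ‖g‖ ≤ ‖F‖ := by
  have hF : ∀ k, 0 ≤ F k := fun k => (norm_nonneg _).trans (hb k)
  simpa using exists_lp_norm_le_rpow_mul_rpow (a := 1) (θ := 1) (C := 1) hq hq (one_mul _)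
    zero_le_one le_rfl zero_le_one hF hF (b := b) (by simpa using hb)

/-- The sequence of coordinate norms. -/
noncomputable def normSeq {q : ℝ≥0∞} {E : ℕ → Type*} [∀ k, NormedAddCommGroup (E k)]
    (s : lp E q) : lp (fun _ : ℕ => ℝ) q :=
  ⟨fun k => ‖s k‖, memℓp_norm_iff.2 (lp.memℓp s)⟩

section
variable {q : ℝ≥0∞} {E : ℕ → Type*} [∀ k, NormedAddCommGroup (E k)]

@[simp] theorem normSeq_apply (s : lp E q) (k : ℕ) : normSeq s k = ‖s k‖ := rfl

theorem norm_normSeq (hq : 0 < q.toReal) (s : lp E q) : ‖normSeq s‖ = ‖s‖ := by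
  simp [lp.norm_eq_tsum_rpow hq]

theorem exists_shift [Fact (1 ≤ q)] (hq : 0 < q.toReal) (f : lp (fun _ : ℕ => ℝ) q) :
    ∃ g : lp (fun _ : ℕ => ℝ) q, g 0 = 0 ∧ (∀ k, g (k + 1) = f k) ∧ ‖g‖ ≤ ‖f‖ := by
  have hsum := (lp.memℓp f).summable hq
  let g : ℕ → ℝ := fun k => Nat.casesOn k 0 f
  have hg : Summable fun k => ‖g k‖ ^ q.toReal := (summable_nat_add_iff 1).1 hsum
  refine ⟨⟨g, memℓp_gen hg⟩, rfl, fun k => rfl, ?_⟩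
  refine lp.norm_le_of_tsum_le hq (norm_nonneg _) ?_
  rw [lp.norm_rpow_eq_tsum hq]
  change ∑' k, ‖g k‖ ^ q.toReal ≤ _
  rw [hg.tsum_eq_zero_add]
  simp [g, Real.zero_rpow hq.ne']

theorem exists_backshift [Fact (1 ≤ q)] (hq : 0 < q.toReal) (f : lp (fun _ : ℕ => ℝ) q) :
    ∃ g : lp (fun _ : ℕ => ℝ) q, (∀ k, g k = f (k + 1)) ∧ ‖g‖ ≤ ‖f‖ := by
  have hsum := (lp.memℓp f).summable hq
  have hg : Summable fun k => ‖f (k + 1)‖ ^ q.toReal := (summable_nat_add_iff 1).2 hsum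
  refine ⟨⟨fun k => f (k + 1), memℓp_gen hg⟩, fun k => rfl, ?_⟩
  refine lp.norm_le_of_tsum_le hq (norm_nonneg _) ?_
  rw [lp.norm_rpow_eq_tsum hq, hsum.tsum_eq_zero_add]
  have : (0 : ℝ) ≤ ‖f 0‖ ^ q.toReal := by positivity
  exact le_add_of_nonneg_left this

theorem exists_window [Fact (1 ≤ q)] (n : ℕ) :
    ∃ g : lp (fun _ : ℕ => ℝ) q, (∀ k, 0 ≤ g k) ∧ (∀ k, n ≤ k → k ≤ n + 2 → g k = 1) ∧
      ‖g‖ ≤ 3 := by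
  have hq : 0 < q := lt_of_lt_of_le one_pos Fact.out
  refine ⟨∑ i ∈ Finset.range 3, lp.single q (n + i) (1 : ℝ), fun k => ?_, fun k h1 h2 => ?_, ?_⟩
  · rw [lp.coeFn_sum, Finset.sum_apply]
    refine Finset.sum_nonneg fun i _ => ?_
    rw [lp.single_apply, Pi.single_apply]
    split_ifs <;> simp
  · obtain ⟨j, rfl⟩ := Nat.exists_eq_add_of_le h1
    have hj : j ∈ Finset.range 3 := by simp; omega
    rw [lp.coeFn_sum, Finset.sum_apply]
    simp only [lp.single_apply, Pi.single_apply, Nat.add_left_cancel_iff]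
    rw [Finset.sum_ite_eq, if_pos hj]
  · refine (norm_sum_le _ _).trans ?_
    simp [lp.norm_single hq]
end

/-- The odd extension of `x ↦ x ^ a` to the real line. -/
noncomputable def signedPow (a x : ℝ) : ℝ := SignType.sign x * |x| ^ a

theorem abs_signedPow {a : ℝ} (ha : 0 < a) (x : ℝ) : |signedPow a x| = |x| ^ a := by
  rcases lt_trichotomy x 0 with h | rfl | h
  · simp [signedPow, sign_neg h, abs_of_nonneg (Real.rpow_nonneg (abs_nonneg x) a)]
  · simp [signedPow, Real.zero_rpow ha.ne']
  · simp [signedPow, sign_pos h, abs_of_nonneg (Real.rpow_nonneg (abs_nonneg x) a)]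

theorem signedPow_of_nonneg {a x : ℝ} (ha : 0 < a) (hx : 0 ≤ x) : signedPow a x = x ^ a := by
  rcases hx.eq_or_lt with rfl | h
  · simp [signedPow, Real.zero_rpow ha.ne']
  · simp [signedPow, sign_pos h, abs_of_pos h]

theorem signedPow_neg (a x : ℝ) : signedPow a (-x) = -signedPow a x := by
  simp [signedPow, Left.sign_neg]

theorem signedPow_mul {a c : ℝ} (ha : 0 < a) (hc : 0 ≤ c) (x : ℝ) :
    signedPow a (c * x) = c ^ a * signedPow a x := by
  rcases hc.eq_or_lt with rfl | h
  · simp [signedPow, Real.zero_rpow ha.ne']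
  · simp only [signedPow, sign_mul, sign_pos h, abs_mul, abs_of_pos h,
      Real.mul_rpow hc (abs_nonneg x), one_mul]
    ring

theorem signedPow_signedPow {a b : ℝ} (ha : 0 < a) (hb : 0 < b) (hab : a * b = 1) (x : ℝ) :
    signedPow b (signedPow a x) = x := by
  have key : ∀ y : ℝ, 0 ≤ y → signedPow b (signedPow a y) = y := fun y hy => by
    rw [signedPow_of_nonneg ha hy, signedPow_of_nonneg hb (by positivity), ← Real.rpow_mul hy, hab,
      Real.rpow_one]
  rcases le_total 0 x with h | h
  · exact key x h
  · have := key (-x) (by linarith)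
    rw [signedPow_neg, signedPow_neg] at this
    linarith

theorem rpow_sub_rpow_le {a θ x y : ℝ} (hθ1 : θ ≤ 1) (hθa : θ ≤ a) (ha2 : a ≤ 2)
    (hy : 0 ≤ y) (hyx : y ≤ x) : x ^ a - y ^ a ≤ 2 * (x - y) ^ θ * (x + y) ^ (a - θ) := by
  rcases hy.eq_or_lt with rfl | hy'
  · rcases hyx.eq_or_lt with rfl | hx
    · simp only [sub_self]; positivity
    · simp only [sub_zero, add_zero]
      rw [mul_assoc, ← Real.rpow_add hx]
      have h1 : (0:ℝ) ≤ x ^ a := by positivity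
      have h2 : (0:ℝ) ≤ (0:ℝ) ^ a := by positivity
      rw [add_sub_cancel]; linarith
  have hx : 0 < x := hy'.trans_le hyx
  set t := y / x with ht
  have ht0 : 0 < t := by positivity
  have ht1 : t ≤ 1 := by rw [ht, div_le_one hx]; exact hyx
  have hyt : y = x * t := by rw [ht]; field_simp
  have h1 : 1 - t ^ a ≤ 2 * (1 - t) ^ θ := by
    have e1 : t ^ (2:ℝ) ≤ t ^ a := Real.rpow_le_rpow_of_exponent_ge ht0 ht1 ha2
    have e2 : (1 - t) ^ (1:ℝ) ≤ (1 - t) ^ θ := by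
      rcases ht1.eq_or_lt with h | h
      · rw [h, sub_self, Real.zero_rpow one_ne_zero]; positivity
      · exact Real.rpow_le_rpow_of_exponent_ge (by linarith) (by linarith) hθ1
    rw [Real.rpow_one] at e2
    rw [Real.rpow_two] at e1
    nlinarith
  have hxy : x - y = x * (1 - t) := by rw [hyt]; ring
  have h2 : x ^ (a - θ) ≤ (x + y) ^ (a - θ) :=
    Real.rpow_le_rpow hx.le (by linarith) (by linarith)
  have h3 : x ^ a = x ^ θ * x ^ (a - θ) := by rw [← Real.rpow_add hx]; ring_nf
  have h4 : y ^ a = x ^ a * t ^ a := by rw [hyt, Real.mul_rpow hx.le ht0.le]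
  have h5 : (0:ℝ) ≤ (1 - t) ^ θ := Real.rpow_nonneg (by linarith) _
  calc x ^ a - y ^ a = x ^ a * (1 - t ^ a) := by rw [h4]; ring
    _ ≤ x ^ a * (2 * (1 - t) ^ θ) := by gcongr
    _ = 2 * (x - y) ^ θ * x ^ (a - θ) := by
        rw [hxy, Real.mul_rpow hx.le (by linarith), h3]; ring
    _ ≤ _ := by
        have : 0 ≤ (x - y) ^ θ := Real.rpow_nonneg (by linarith) _
        gcongr

theorem abs_signedPow_sub_le {a θ : ℝ} (ha : 0 < a) (hθ0 : 0 ≤ θ) (hθ1 : θ ≤ 1) (hθa : θ ≤ a)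
    (ha2 : a ≤ 2) (x y : ℝ) :
    |signedPow a x - signedPow a y| ≤ 2 * |x - y| ^ θ * (|x| + |y|) ^ (a - θ) := by
  wlog hxy : |y| ≤ |x| generalizing x y
  · have := this y x (le_of_not_ge hxy)
    rwa [abs_sub_comm, abs_sub_comm x, add_comm |x|]
  wlog hx : 0 ≤ x generalizing x y
  · have := this (-x) (-y) (by simpa using hxy) (by linarith)
    simp only [signedPow_neg, abs_neg] at this
    rw [show -x - -y = -(x - y) by ring, abs_neg,
      show -signedPow a x - -signedPow a y = -(signedPow a x - signedPow a y) by ring,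
      abs_neg] at this
    exact this
  rw [abs_of_nonneg hx] at hxy
  rcases le_total 0 y with hy | hy
  · rw [abs_of_nonneg hy] at hxy
    rw [signedPow_of_nonneg ha hx, signedPow_of_nonneg ha hy, abs_of_nonneg hx, abs_of_nonneg hy,
      abs_of_nonneg (sub_nonneg.2 hxy),
      abs_of_nonneg (sub_nonneg.2 (Real.rpow_le_rpow hy hxy ha.le))]
    exact rpow_sub_rpow_le hθ1 hθa ha2 hy hxy
  · rw [abs_of_nonpos hy] at hxy
    obtain ⟨z, rfl⟩ : ∃ z, y = -z := ⟨-y, by simp⟩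
    have hz : 0 ≤ z := by linarith
    rw [neg_neg] at hxy
    rw [signedPow_neg, signedPow_of_nonneg ha hx, signedPow_of_nonneg ha hz, sub_neg_eq_add,
      sub_neg_eq_add, abs_neg, abs_of_nonneg hx, abs_of_nonneg hz, abs_of_nonneg (by positivity),
      abs_of_nonneg (by positivity), mul_assoc, ← Real.rpow_add_of_nonneg (by positivity) hθ0
        (by linarith), add_sub_cancel, two_mul]
    exact add_le_add (Real.rpow_le_rpow hx (by linarith) ha.le)
      (Real.rpow_le_rpow hz (by linarith) ha.le)

/-- A Hölder condition, with exponent `θ`, in the form invariant under rescaling. -/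
def HomHolder {A B : Type*} [NormedAddCommGroup A] [NormedAddCommGroup B] (C θ : ℝ)
    (f : A → B) : Prop :=
  ∀ x y, ‖f x - f y‖ ≤ C * ‖x - y‖ ^ θ * (‖x‖ + ‖y‖) ^ (1 - θ)

theorem le_rpow_mul_rpow {d ρ θ : ℝ} (hd : 0 ≤ d) (hdρ : d ≤ ρ) (hθ0 : 0 ≤ θ) (hθ1 : θ ≤ 1) :
    d ≤ d ^ θ * ρ ^ (1 - θ) := by
  calc d = d ^ θ * d ^ (1 - θ) := by
        rw [← Real.rpow_add_of_nonneg hd hθ0 (by linarith), add_sub_cancel, Real.rpow_one]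
    _ ≤ _ := by gcongr

section Mazur
variable (r s : ℝ≥0∞) [Fact (1 ≤ r)]

theorem exists_mazurMap (hr : 0 < r.toReal) (hs : 0 < s.toReal) (x : lp (fun _ : ℕ => ℝ) r) :
    ∃ g : lp (fun _ : ℕ => ℝ) s,
      ∀ k, g k = ‖x‖ ^ (1 - r.toReal / s.toReal) * signedPow (r.toReal / s.toReal) (x k) := by
  have ha : 0 < r.toReal / s.toReal := by positivity
  obtain ⟨g, hg, -⟩ := exists_lp_norm_le_rpow_mul_rpow (r := r) (s := s) (E := fun _ => ℝ)
    (a := r.toReal / s.toReal) (θ := 0) (C := 1) hr hs (by field_simp) le_rfl ha.le zero_le_one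
    (F := normSeq x) (P := normSeq x) (fun _ => norm_nonneg _) (fun _ => norm_nonneg _)
    (b := fun k => signedPow (r.toReal / s.toReal) (x k)) (by
      intro k
      simp [Real.norm_eq_abs, abs_signedPow ha])
  exact ⟨‖x‖ ^ (1 - r.toReal / s.toReal) • g, fun k => by simp [hg]⟩

open Classical in
/-- The norm preserving, positively homogeneous Mazur map from `ℓ_r` to `ℓ_s`
(and `0` when `r` or `s` is infinite). -/
noncomputable def mazurMap (x : lp (fun _ : ℕ => ℝ) r) : lp (fun _ : ℕ => ℝ) s :=
  if h : 0 < r.toReal ∧ 0 < s.toReal then (exists_mazurMap r s h.1 h.2 x).choose else 0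

variable {r s}

theorem mazurMap_apply (hr : 0 < r.toReal) (hs : 0 < s.toReal)
    (x : lp (fun _ : ℕ => ℝ) r) (k : ℕ) :
    mazurMap r s x k
      = ‖x‖ ^ (1 - r.toReal / s.toReal) * signedPow (r.toReal / s.toReal) (x k) := by
  rw [mazurMap, dif_pos ⟨hr, hs⟩]
  exact (exists_mazurMap r s hr hs x).choose_spec k

theorem mazurMap_zero (hr : 0 < r.toReal) (hs : 0 < s.toReal) :
    mazurMap r s 0 = 0 := by
  ext k
  simp [mazurMap_apply hr hs, signedPow]

theorem norm_mazurMap [Fact (1 ≤ s)] (hr : 0 < r.toReal) (hs : 0 < s.toReal)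
    (x : lp (fun _ : ℕ => ℝ) r) : ‖mazurMap r s x‖ = ‖x‖ := by
  by_cases hx : x = 0
  · simp [hx, mazurMap_zero hr hs]
  have hx' : 0 < ‖x‖ := norm_pos_iff.2 hx
  have ha : 0 < r.toReal / s.toReal := by positivity
  have h : ‖mazurMap r s x‖ ^ s.toReal = ‖x‖ ^ s.toReal := by
    rw [lp.norm_rpow_eq_tsum hs]
    simp only [mazurMap_apply hr hs, norm_mul, Real.norm_eq_abs, abs_signedPow ha]
    have e : ∀ k, (|‖x‖ ^ (1 - r.toReal / s.toReal)| * |x k| ^ (r.toReal / s.toReal)) ^ s.toReal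
        = ‖x‖ ^ (s.toReal - r.toReal) * ‖x k‖ ^ r.toReal := fun k => by
      rw [abs_of_nonneg (by positivity), Real.mul_rpow (by positivity) (by positivity),
        ← Real.rpow_mul hx'.le, ← Real.rpow_mul (abs_nonneg _), Real.norm_eq_abs]
      congr 2 <;> field_simp
    simp only [e]
    rw [tsum_mul_left, ← lp.norm_rpow_eq_tsum hr, ← Real.rpow_add hx']
    ring_nf
  exact (Real.rpow_left_inj (norm_nonneg _) (norm_nonneg _) hs.ne').1 h

theorem mazurMap_mazurMap [Fact (1 ≤ s)] (hr : 0 < r.toReal) (hs : 0 < s.toReal)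
    (x : lp (fun _ : ℕ => ℝ) r) : mazurMap s r (mazurMap r s x) = x := by
  by_cases hx : x = 0
  · simp [hx, mazurMap_zero hr hs, mazurMap_zero hs hr]
  have hx' : 0 < ‖x‖ := norm_pos_iff.2 hx
  have ha : 0 < r.toReal / s.toReal := by positivity
  have hb : 0 < s.toReal / r.toReal := by positivity
  ext k
  rw [mazurMap_apply hs hr, norm_mazurMap hr hs, mazurMap_apply hr hs,
    signedPow_mul hb (by positivity), signedPow_signedPow ha hb (by field_simp), ← mul_assoc,
    ← Real.rpow_mul hx'.le, ← Real.rpow_add hx']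
  have : 1 - s.toReal / r.toReal + (1 - r.toReal / s.toReal) * (s.toReal / r.toReal) = 0 := by
    field_simp; ring
  rw [this, Real.rpow_zero, one_mul]

theorem mazurMap_smul (hr : 0 < r.toReal) (hs : 0 < s.toReal)
    {c : ℝ} (hc : 0 ≤ c) (x : lp (fun _ : ℕ => ℝ) r) :
    mazurMap r s (c • x) = c • mazurMap r s x := by
  rcases hc.eq_or_lt with rfl | hc'
  · simp [mazurMap_zero hr hs]
  have ha : 0 < r.toReal / s.toReal := by positivity
  ext k
  rw [mazurMap_apply hr hs, lp.coeFn_smul, lp.coeFn_smul, Pi.smul_apply, Pi.smul_apply,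
    smul_eq_mul, smul_eq_mul, signedPow_mul ha hc, mazurMap_apply hr hs, norm_smul,
    Real.norm_of_nonneg hc, Real.mul_rpow hc (norm_nonneg _)]
  have : c ^ (1 - r.toReal / s.toReal) * c ^ (r.toReal / s.toReal) = c := by
    rw [← Real.rpow_add hc', sub_add_cancel, Real.rpow_one]
  linear_combination
    (‖x‖ ^ (1 - r.toReal / s.toReal) * signedPow (r.toReal / s.toReal) (x k)) * this

theorem norm_mazurMap_sub_le_of_norm_eq [Fact (1 ≤ s)] (hr : 0 < r.toReal) (hs : 0 < s.toReal)
    {θ : ℝ} (hθ0 : 0 ≤ θ) (hθ1 : θ ≤ 1)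
    (hθa : θ ≤ r.toReal / s.toReal) (ha2 : r.toReal / s.toReal ≤ 2)
    {x y : lp (fun _ : ℕ => ℝ) r} (hxy : ‖x‖ = ‖y‖) :
    ‖mazurMap r s x - mazurMap r s y‖ ≤ 8 * ‖x - y‖ ^ θ * ‖x‖ ^ (1 - θ) := by
  by_cases hx : x = 0
  · have hy : y = 0 := by rw [hx, norm_zero] at hxy; exact norm_eq_zero.1 hxy.symm
    simp only [hx, hy, sub_self, norm_zero]; positivity
  have hx' : 0 < ‖x‖ := norm_pos_iff.2 hx
  have ha : 0 < r.toReal / s.toReal := by positivity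
  obtain ⟨g, hg, hgn⟩ := exists_lp_norm_le_rpow_mul_rpow (r := r) (s := s) (E := fun _ => ℝ)
    (a := r.toReal / s.toReal) (θ := θ) (C := 2) hr hs (by field_simp) hθ0 hθa zero_le_two
    (F := normSeq (x - y)) (P := normSeq x + normSeq y) (fun _ => norm_nonneg _)
    (fun k => add_nonneg (norm_nonneg (x k)) (norm_nonneg (y k)))
    (b := fun k => signedPow (r.toReal / s.toReal) (x k) - signedPow (r.toReal / s.toReal) (y k))
    (fun k => abs_signedPow_sub_le ha hθ0 hθ1 hθa ha2 (x k) (y k))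
  have he : mazurMap r s x - mazurMap r s y = ‖x‖ ^ (1 - r.toReal / s.toReal) • g := by
    ext k
    simp [mazurMap_apply hr hs, hg, ← hxy, mul_sub]
  have hP : ‖normSeq x + normSeq y‖ ≤ 2 * ‖x‖ := by
    refine (norm_add_le _ _).trans_eq ?_
    rw [norm_normSeq hr, norm_normSeq hr, ← hxy]; ring
  have h4 : (2:ℝ) ^ (r.toReal / s.toReal - θ) ≤ 4 := by
    calc (2:ℝ) ^ (r.toReal / s.toReal - θ) ≤ 2 ^ (2:ℝ) :=
          Real.rpow_le_rpow_of_exponent_le one_le_two (by linarith)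
      _ = 4 := by norm_num
  rw [he, norm_smul, Real.norm_of_nonneg (by positivity)]
  rw [norm_normSeq hr] at hgn
  calc ‖x‖ ^ (1 - r.toReal / s.toReal) * ‖g‖
      ≤ ‖x‖ ^ (1 - r.toReal / s.toReal) *
        (2 * ‖x - y‖ ^ θ * (2 * ‖x‖) ^ (r.toReal / s.toReal - θ)) := by
        gcongr
        refine hgn.trans ?_
        gcongr
    _ = 2 ^ (r.toReal / s.toReal - θ) * (2 * ‖x - y‖ ^ θ *
        (‖x‖ ^ (1 - r.toReal / s.toReal) * ‖x‖ ^ (r.toReal / s.toReal - θ))) := by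
        rw [Real.mul_rpow zero_le_two hx'.le]; ring
    _ = 2 ^ (r.toReal / s.toReal - θ) * (2 * ‖x - y‖ ^ θ * ‖x‖ ^ (1 - θ)) := by
        rw [← Real.rpow_add hx']; ring_nf
    _ ≤ 4 * (2 * ‖x - y‖ ^ θ * ‖x‖ ^ (1 - θ)) := by gcongr
    _ = _ := by ring

theorem homHolder_mazurMap [Fact (1 ≤ s)] (hr : 0 < r.toReal) (hs : 0 < s.toReal)
    {θ : ℝ} (hθ0 : 0 ≤ θ) (hθ1 : θ ≤ 1)
    (hθa : θ ≤ r.toReal / s.toReal) (ha2 : r.toReal / s.toReal ≤ 2) :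
    HomHolder 17 θ (mazurMap r s) := by
  intro x y
  by_cases hx : x = 0
  · subst hx
    rw [mazurMap_zero hr hs, zero_sub, norm_neg, norm_mazurMap hr hs, zero_sub, norm_neg, norm_zero,
      zero_add, mul_assoc]
    have := le_rpow_mul_rpow (norm_nonneg y) le_rfl hθ0 hθ1
    nlinarith [norm_nonneg y]
  by_cases hy : y = 0
  · subst hy
    rw [mazurMap_zero hr hs, sub_zero, norm_mazurMap hr hs, sub_zero, norm_zero, add_zero,
      mul_assoc]
    have := le_rpow_mul_rpow (norm_nonneg x) le_rfl hθ0 hθ1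
    nlinarith [norm_nonneg x]
  have hx' : 0 < ‖x‖ := norm_pos_iff.2 hx
  have hy' : 0 < ‖y‖ := norm_pos_iff.2 hy
  set c := ‖x‖ / ‖y‖ with hc
  have hc0 : 0 ≤ c := by positivity
  have hcy : c * ‖y‖ = ‖x‖ := by rw [hc]; field_simp
  have hnc : ‖x‖ = ‖c • y‖ := by rw [norm_smul, Real.norm_of_nonneg hc0, hcy]
  have hd : |‖x‖ - ‖y‖| ≤ ‖x - y‖ := abs_norm_sub_norm_le x y
  have h1 := norm_mazurMap_sub_le_of_norm_eq hr hs hθ0 hθ1 hθa ha2 hnc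
  have hcy2 : ∀ {E : Type} [NormedAddCommGroup E] [NormedSpace ℝ E] (z : E), ‖z‖ = ‖y‖ →
      ‖c • z - z‖ ≤ ‖x - y‖ := by
    intro E _ _ z hz
    rw [show c • z - z = (c - 1) • z by rw [sub_smul, one_smul], norm_smul, hz, Real.norm_eq_abs,
      ← abs_of_pos hy', ← abs_mul, sub_mul, hcy, one_mul]
    exact hd
  have h2 : ‖mazurMap r s (c • y) - mazurMap r s y‖ ≤ ‖x - y‖ := by
    rw [mazurMap_smul hr hs hc0]
    exact hcy2 _ (norm_mazurMap hr hs y)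
  have h3 : ‖x - c • y‖ ≤ 2 * ‖x - y‖ := by
    have h := norm_sub_le_norm_sub_add_norm_sub x y (c • y)
    have h' := hcy2 y rfl
    rw [norm_sub_rev] at h'
    linarith
  have h4 : (2 : ℝ) ^ θ ≤ 2 := by
    simpa using Real.rpow_le_rpow_of_exponent_le one_le_two hθ1
  have h5 := le_rpow_mul_rpow (norm_nonneg (x - y)) (norm_sub_le x y) hθ0 hθ1
  calc ‖mazurMap r s x - mazurMap r s y‖
      ≤ ‖mazurMap r s x - mazurMap r s (c • y)‖ + ‖mazurMap r s (c • y) - mazurMap r s y‖ :=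
        norm_sub_le_norm_sub_add_norm_sub _ _ _
    _ ≤ 8 * (2 * ‖x - y‖ ^ θ) * (‖x‖ + ‖y‖) ^ (1 - θ)
        + ‖x - y‖ ^ θ * (‖x‖ + ‖y‖) ^ (1 - θ) := by
        refine add_le_add (h1.trans ?_) (h2.trans h5)
        gcongr
        · calc ‖x - c • y‖ ^ θ ≤ (2 * ‖x - y‖) ^ θ := by gcongr
            _ = 2 ^ θ * ‖x - y‖ ^ θ := Real.mul_rpow zero_le_two (norm_nonneg _)
            _ ≤ _ := by gcongr
        · linarith
    _ = _ := by ring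

end Mazur

section Normalize
variable {A B : Type*} [NormedAddCommGroup A] [NormedAddCommGroup B] [NormedSpace ℝ B]

theorem uniformContinuous_normalize {f : A → B} (hf : UniformContinuous f) {K : ℝ} (hK : 0 ≤ K)
    (hfK : ∀ x, ‖x‖ ≤ K * ‖f x‖) : UniformContinuous fun x => (‖x‖ / ‖f x‖) • f x := by
  have key : ∀ x y, ‖(‖x‖ / ‖f x‖) • f x - (‖y‖ / ‖f y‖) • f y‖ ≤
      ‖x - y‖ + 2 * K * ‖f x - f y‖ := by
    intro x y
    have hρ : ∀ z, ‖z‖ / ‖f z‖ * ‖f z‖ = ‖z‖ := fun z => by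
      by_cases h : ‖f z‖ = 0
      · have := hfK z
        rw [h, mul_zero] at this
        rw [h, mul_zero]; exact (le_antisymm this (norm_nonneg _)).symm
      · field_simp
    have hρK : ‖x‖ / ‖f x‖ ≤ K := div_le_of_le_mul₀ (norm_nonneg _) hK (hfK x)
    have hρ0 : 0 ≤ ‖x‖ / ‖f x‖ := by positivity
    have e : (‖x‖ / ‖f x‖) • f x - (‖y‖ / ‖f y‖) • f y
        = (‖x‖ / ‖f x‖) • (f x - f y) + (‖x‖ / ‖f x‖ - ‖y‖ / ‖f y‖) • f y := by
      rw [smul_sub, sub_smul]; abel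
    have h2 : ‖(‖x‖ / ‖f x‖ - ‖y‖ / ‖f y‖) • f y‖ ≤ K * ‖f x - f y‖ + ‖x - y‖ := by
      rw [norm_smul, Real.norm_eq_abs, ← abs_of_nonneg (norm_nonneg (f y)), ← abs_mul,
        abs_of_nonneg (norm_nonneg (f y)), sub_mul, hρ y,
        show ‖x‖ / ‖f x‖ * ‖f y‖ - ‖y‖
          = ‖x‖ / ‖f x‖ * (‖f y‖ - ‖f x‖) + (‖x‖ - ‖y‖) by rw [mul_sub, hρ x]; ring]
      refine (abs_add_le _ _).trans (add_le_add ?_ (abs_norm_sub_norm_le x y))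
      rw [abs_mul, abs_of_nonneg hρ0, abs_sub_comm]
      exact mul_le_mul hρK (abs_norm_sub_norm_le _ _) (abs_nonneg _) hK
    rw [e]
    refine (norm_add_le _ _).trans ?_
    have h1 : ‖(‖x‖ / ‖f x‖) • (f x - f y)‖ ≤ K * ‖f x - f y‖ := by
      rw [norm_smul, Real.norm_of_nonneg hρ0]; gcongr
    linarith
  rw [Metric.uniformContinuous_iff] at hf ⊢
  intro ε hε
  obtain ⟨δ, hδ, h⟩ := hf (ε / (2 * (2 * K + 1))) (by positivity)
  refine ⟨min δ (ε / 2), by positivity, fun {x y} hxy => ?_⟩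
  have h1 := h (hxy.trans_le (min_le_left _ _))
  have h2 := hxy.trans_le (min_le_right _ _)
  rw [dist_eq_norm] at h1 h2 ⊢
  refine (key x y).trans_lt ?_
  have h3 : 2 * K * ‖f x - f y‖ ≤ ε / 2 := by
    rw [lt_div_iff₀ (by positivity)] at h1
    nlinarith [norm_nonneg (f x - f y)]
  linarith

variable [NormedSpace ℝ A]

theorem normalize_normalize {f : A → B} {f' : B → A} {K : ℝ} (hf : ∀ x, f' (f x) = x)
    (hc : ∀ (c : ℝ) (y), 0 ≤ c → f' (c • y) = c • f' y) (hfK : ∀ x, ‖x‖ ≤ K * ‖f x‖) (x : A) :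
    ‖(‖x‖ / ‖f x‖) • f x‖ = ‖x‖ ∧
      (‖x‖ / ‖f' ((‖x‖ / ‖f x‖) • f x)‖) • f' ((‖x‖ / ‖f x‖) • f x) = x := by
  by_cases hx : x = 0
  · subst hx
    have : f' 0 = 0 := by simpa using hc 0 0 le_rfl
    simp [this]
  have hx' : 0 < ‖x‖ := norm_pos_iff.2 hx
  have hfx : 0 < ‖f x‖ := by
    by_contra h
    have h0 : ‖f x‖ = 0 := le_antisymm (not_lt.1 h) (norm_nonneg _)
    have := hfK x
    rw [h0, mul_zero] at this
    linarith
  have hρ : 0 < ‖x‖ / ‖f x‖ := by positivity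
  refine ⟨by rw [norm_smul, Real.norm_of_nonneg hρ.le]; field_simp, ?_⟩
  rw [hc _ _ hρ.le, hf, norm_smul, Real.norm_of_nonneg hρ.le, smul_smul]
  have : ‖x‖ / (‖x‖ / ‖f x‖ * ‖x‖) * (‖x‖ / ‖f x‖) = 1 := by field_simp
  rw [this, one_smul]

theorem nonempty_uniformEquiv_of_homogeneous (g : ℝ → A ≃ B) {K : ℝ} (hK : 0 ≤ K)
    (hg : ∀ r x, ‖g r x‖ ≤ K * ‖x‖) (hg' : ∀ r y, ‖(g r).symm y‖ ≤ K * ‖y‖)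
    (hs : ∀ r (c : ℝ) x, 0 ≤ c → g r (c • x) = c • g r x)
    (hu : UniformContinuous fun x => g ‖x‖ x)
    (hu' : UniformContinuous fun y => (g ‖y‖).symm y) : Nonempty (A ≃ᵤ B) := by
  have hs' : ∀ r (c : ℝ) y, 0 ≤ c → (g r).symm (c • y) = c • (g r).symm y := fun r c y hc => by
    rw [Equiv.symm_apply_eq, hs r c _ hc, Equiv.apply_symm_apply]
  have h1 : ∀ r x, ‖x‖ ≤ K * ‖g r x‖ := fun r x => by simpa using hg' r (g r x)
  have h2 : ∀ r y, ‖y‖ ≤ K * ‖(g r).symm y‖ := fun r y => by simpa using hg r ((g r).symm y)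
  refine ⟨{ toFun := fun x => (‖x‖ / ‖g ‖x‖ x‖) • g ‖x‖ x
            invFun := fun y => (‖y‖ / ‖(g ‖y‖).symm y‖) • (g ‖y‖).symm y
            left_inv := fun x => ?_
            right_inv := fun y => ?_
            uniformContinuous_toFun := uniformContinuous_normalize hu hK fun x => h1 _ x
            uniformContinuous_invFun := uniformContinuous_normalize hu' hK fun x => h2 _ x }⟩
  · obtain ⟨e1, e2⟩ := normalize_normalize (f' := (g ‖x‖).symm) (g ‖x‖).symm_apply_apply
      (hs' _) (h1 _) x
    simp only [e1, e2]
  · obtain ⟨e1, e2⟩ := normalize_normalize (f' := g ‖y‖) (g ‖y‖).apply_symm_apply (hs _) (h2 _) y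
    simp only [e1, e2]

/-- The Hölder exponents that allow control on balls whose radius grows exponentially. -/
noncomputable def expo (n : ℕ) : ℝ := 1 - 1 / (n + 2)

theorem half_le_expo (n : ℕ) : 1 / 2 ≤ expo n := by
  have h : (1 : ℝ) / (n + 2) ≤ 1 / 2 := by gcongr; linarith [n.cast_nonneg (α := ℝ)]
  unfold expo; linarith

theorem expo_nonneg (n : ℕ) : 0 ≤ expo n := by linarith [half_le_expo n]

theorem expo_lt_one (n : ℕ) : expo n < 1 := by
  have : (0 : ℝ) < 1 / (n + 2) := by positivity
  unfold expo; linarith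

theorem expo_mono {n k : ℕ} (h : n ≤ k) : expo n ≤ expo k := by
  have : (n : ℝ) ≤ k := by exact_mod_cast h
  unfold expo; gcongr

theorem uniformContinuous_of_expo {A B : Type*} [NormedAddCommGroup A] [NormedAddCommGroup B]
    {f : A → B} {K : ℝ} (hK : 0 ≤ K)
    (hf : ∀ (n : ℕ) (x y : A),
      n ≤ Real.log (1 + ‖x‖) → n ≤ Real.log (1 + ‖y‖) →
      Real.log (1 + ‖x‖) < n + 2 → Real.log (1 + ‖y‖) < n + 2 →
      |Real.log (1 + ‖x‖) - Real.log (1 + ‖y‖)| * (‖x‖ + ‖y‖) ≤ 2 * ‖x - y‖ →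
      ‖f x - f y‖ ≤
        K * ‖x - y‖ ^ (expo n * expo n) * (‖x‖ + ‖y‖) ^ (1 - expo n * expo n)) :
    UniformContinuous f := by
  have key : ∀ x y : A, ‖x - y‖ ≤ 1 →
      ‖f x - f y‖ ≤ K * ‖x - y‖ ^ (1 / 4 : ℝ) * Real.exp 2 := by
    intro x y hxy
    wlog hle : ‖x‖ ≤ ‖y‖ generalizing x y
    · have := this y x (by rwa [norm_sub_rev]) (le_of_not_ge hle)
      rwa [norm_sub_rev, norm_sub_rev x]
    have hd : ‖y‖ - ‖x‖ ≤ ‖x - y‖ := by rw [norm_sub_rev]; exact norm_sub_norm_le y x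
    have hx0 := norm_nonneg x
    have hx1 : 0 < 1 + ‖x‖ := by positivity
    have hy1 : 0 < 1 + ‖y‖ := by positivity
    have hlog : Real.log (1 + ‖x‖) ≤ Real.log (1 + ‖y‖) := Real.log_le_log hx1 (by linarith)
    have hδ : Real.log (1 + ‖y‖) - Real.log (1 + ‖x‖) ≤ ‖x - y‖ / (1 + ‖x‖) := by
      rw [← Real.log_div hy1.ne' hx1.ne']
      refine (Real.log_le_sub_one_of_pos (by positivity)).trans ?_
      rw [div_sub_one hx1.ne']
      gcongr
      linarith
    have hδ1 : ‖x - y‖ / (1 + ‖x‖) ≤ 1 := by rw [div_le_one hx1]; linarith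
    have habs : |Real.log (1 + ‖x‖) - Real.log (1 + ‖y‖)|
        = Real.log (1 + ‖y‖) - Real.log (1 + ‖x‖) := by
      rw [abs_sub_comm, abs_of_nonneg (by linarith)]
    have hN : ‖x‖ + ‖y‖ ≤ 2 * (1 + ‖x‖) := by linarith
    have hl0 : 0 ≤ Real.log (1 + ‖x‖) := Real.log_nonneg (by linarith)
    set n := ⌊Real.log (1 + ‖x‖)⌋₊ with hn
    have hn1 : (n : ℝ) ≤ Real.log (1 + ‖x‖) := Nat.floor_le hl0
    have hn2 : Real.log (1 + ‖x‖) < n + 1 := Nat.lt_floor_add_one _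
    have := hf n x y hn1 (hn1.trans hlog) (by linarith) (by linarith) (by
        rw [habs]
        calc _ ≤ ‖x - y‖ / (1 + ‖x‖) * (2 * (1 + ‖x‖)) := by gcongr
          _ = _ := by field_simp)
    refine this.trans ?_
    have hE := half_le_expo n
    have hE1 := (expo_lt_one n).le
    have e1 : ‖x - y‖ ^ (expo n * expo n) ≤ ‖x - y‖ ^ (1 / 4 : ℝ) :=
      Real.rpow_le_rpow_of_exponent_ge_of_imp (norm_nonneg _) hxy (by nlinarith)
        (fun _ h => absurd h (by nlinarith))
    have hN2 : ‖x‖ + ‖y‖ ≤ Real.exp (n + 2) := by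
      have h1 : 1 + ‖x‖ ≤ Real.exp (n + 1) := by
        rw [← Real.exp_log hx1]; exact Real.exp_le_exp.2 hn2.le
      have h2 : (2 : ℝ) ≤ Real.exp 1 := by linarith [Real.add_one_le_exp (1 : ℝ)]
      calc ‖x‖ + ‖y‖ ≤ Real.exp 1 * Real.exp (n + 1) :=
            hN.trans (mul_le_mul h2 h1 hx1.le (Real.exp_pos _).le)
        _ = _ := by rw [← Real.exp_add]; ring_nf
    have e2 : (‖x‖ + ‖y‖) ^ (1 - expo n * expo n) ≤ Real.exp 2 := by
      calc (‖x‖ + ‖y‖) ^ (1 - expo n * expo n)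
          ≤ Real.exp (n + 2) ^ (1 - expo n * expo n) :=
            Real.rpow_le_rpow (by positivity) hN2 (by nlinarith)
        _ = Real.exp ((n + 2) * (1 - expo n * expo n)) := by rw [Real.exp_mul]
        _ ≤ Real.exp 2 := by
            refine Real.exp_le_exp.2 ?_
            have h3 : ((n : ℝ) + 2) * (1 - expo n) = 1 := by
              unfold expo; field_simp; ring
            have h4 : ((n : ℝ) + 2) * (1 - expo n * expo n)
              = ((n : ℝ) + 2) * (1 - expo n) * (1 + expo n) := by ring
            rw [h4, h3]; linarith
    gcongr
  rw [Metric.uniformContinuous_iff]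
  intro ε hε
  have hL : 0 < K * Real.exp 2 + 1 := by positivity
  refine ⟨min 1 ((ε / (K * Real.exp 2 + 1)) ^ (4 : ℝ)), by positivity, fun {x y} hxy => ?_⟩
  rw [dist_eq_norm] at hxy ⊢
  have h1 := (hxy.trans_le (min_le_left _ _)).le
  have h2 := (hxy.trans_le (min_le_right _ _)).le
  have h3 : ‖x - y‖ ^ (1 / 4 : ℝ) ≤ ε / (K * Real.exp 2 + 1) := by
    refine (Real.rpow_le_rpow (norm_nonneg _) h2 (by norm_num)).trans_eq ?_
    rw [← Real.rpow_mul (by positivity)]; norm_num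
  calc _ ≤ K * ‖x - y‖ ^ (1 / 4 : ℝ) * Real.exp 2 := key x y h1
    _ ≤ K * (ε / (K * Real.exp 2 + 1)) * Real.exp 2 := by gcongr
    _ = ε * (K * Real.exp 2 / (K * Real.exp 2 + 1)) := by ring
    _ < ε * 1 := by
        refine mul_lt_mul_of_pos_left ?_ hε
        rw [div_lt_one hL]; linarith
    _ = ε := mul_one ε

end Normalize

section Coefficients

/-- A path from `1` to `0` on `[0, 1]`, constant outside. -/
noncomputable def stepCos (u : ℝ) : ℝ := Real.cos (Real.pi / 2 * max 0 (min u 1))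

/-- A path from `0` to `1` on `[0, 1]`, constant outside. -/
noncomputable def stepSin (u : ℝ) : ℝ := Real.sin (Real.pi / 2 * max 0 (min u 1))

theorem stepCos_of_nonpos {u : ℝ} (h : u ≤ 0) : stepCos u = 1 := by
  rw [stepCos, max_eq_left ((min_le_left _ _).trans h)]; simp

theorem stepSin_of_nonpos {u : ℝ} (h : u ≤ 0) : stepSin u = 0 := by
  rw [stepSin, max_eq_left ((min_le_left _ _).trans h)]; simp

theorem stepCos_of_one_le {u : ℝ} (h : 1 ≤ u) : stepCos u = 0 := by
  rw [stepCos, min_eq_right h]; simp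

theorem stepSin_of_one_le {u : ℝ} (h : 1 ≤ u) : stepSin u = 1 := by
  rw [stepSin, min_eq_right h]; simp

theorem stepSin_sq_add_stepCos_sq (u : ℝ) : stepSin u * stepSin u + stepCos u * stepCos u = 1 := by
  have := Real.sin_sq_add_cos_sq (Real.pi / 2 * max 0 (min u 1))
  rw [stepSin, stepCos]; linarith

theorem abs_stepCos_le (u : ℝ) : |stepCos u| ≤ 1 := Real.abs_cos_le_one _

theorem abs_stepSin_le (u : ℝ) : |stepSin u| ≤ 1 := Real.abs_sin_le_one _

theorem abs_clamp_sub_le (u v : ℝ) :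
    |Real.pi / 2 * max 0 (min u 1) - Real.pi / 2 * max 0 (min v 1)| ≤ 2 * |u - v| := by
  rw [← mul_sub, abs_mul, abs_of_pos (by positivity)]
  have h1 : |max 0 (min u 1) - max 0 (min v 1)| ≤ |u - v| :=
    (abs_max_sub_max_le_max _ _ _ _).trans (max_le (by simp)
      ((abs_min_sub_min_le_max _ _ _ _).trans (max_le le_rfl (by simp))))
  have h2 : Real.pi / 2 ≤ 2 := by linarith [Real.pi_le_four]
  exact mul_le_mul h2 h1 (abs_nonneg _) zero_le_two

theorem abs_stepCos_sub_le (u v : ℝ) : |stepCos u - stepCos v| ≤ 2 * |u - v| :=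
  (Real.abs_cos_sub_cos_le _ _).trans (abs_clamp_sub_le u v)

theorem abs_stepSin_sub_le (u v : ℝ) : |stepSin u - stepSin v| ≤ 2 * |u - v| :=
  (Real.abs_sin_sub_sin_le _ _).trans (abs_clamp_sub_le u v)

/-- The coefficient of the extra summand in position `k` at time `τ`. -/
noncomputable def headCoeff (k : ℕ) (τ : ℝ) : ℝ :=
  (-1) ^ k * (stepSin (τ - k + 1) * stepCos (τ - k))

theorem headCoeff_of_add_one_le {k : ℕ} {τ : ℝ} (h : (k : ℝ) + 1 ≤ τ) : headCoeff k τ = 0 := by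
  rw [headCoeff, stepCos_of_one_le (by linarith)]; simp

theorem headCoeff_of_le_sub_one {k : ℕ} {τ : ℝ} (h : τ + 1 ≤ k) : headCoeff k τ = 0 := by
  rw [headCoeff, stepSin_of_nonpos (by linarith)]; simp

theorem abs_headCoeff_le (k : ℕ) (τ : ℝ) : |headCoeff k τ| ≤ 1 := by
  rw [headCoeff, abs_mul, abs_mul, abs_pow, abs_neg, abs_one, one_pow, one_mul]
  exact mul_le_one₀ (abs_stepSin_le _) (abs_nonneg _) (abs_stepCos_le _)

theorem abs_headCoeff_sub_le (k : ℕ) (τ σ : ℝ) :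
    |headCoeff k τ - headCoeff k σ| ≤ 4 * |τ - σ| := by
  have h1 := abs_stepSin_sub_le (τ - k + 1) (σ - k + 1)
  have h2 := abs_stepCos_sub_le (τ - k) (σ - k)
  rw [show τ - k + 1 - (σ - k + 1) = τ - σ by ring] at h1
  rw [show τ - k - (σ - k) = τ - σ by ring] at h2
  rw [headCoeff, headCoeff, ← mul_sub, abs_mul, abs_pow, abs_neg, abs_one, one_pow, one_mul,
    show stepSin (τ - k + 1) * stepCos (τ - k) - stepSin (σ - k + 1) * stepCos (σ - k)
      = (stepSin (τ - k + 1) - stepSin (σ - k + 1)) * stepCos (τ - k)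
        + stepSin (σ - k + 1) * (stepCos (τ - k) - stepCos (σ - k)) by ring]
  refine (abs_add_le _ _).trans ?_
  rw [abs_mul, abs_mul]
  have h3 := abs_stepCos_le (τ - k)
  have h4 := abs_stepSin_le (σ - k + 1)
  nlinarith [abs_nonneg (stepSin (τ - k + 1) - stepSin (σ - k + 1)),
    abs_nonneg (stepCos (τ - k) - stepCos (σ - k))]

end Coefficients

section Rotation
variable {Y : Type*} [NormedAddCommGroup Y] [NormedSpace ℝ Y]

/-- The sequence `a` shifted to the right, with `0` in front. -/
def shiftSeq (a : ℕ → Y) : ℕ → Y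
  | 0 => 0
  | k + 1 => a k

/-- The rotation, at time `τ`, of the sequence `a` that inserts the vector `x`: for `τ = n` the
result is `a 0, …, a (n - 1), ± x, a n, …`. -/
noncomputable def insertSeq (τ : ℝ) (x : Y) (a : ℕ → Y) (k : ℕ) : Y :=
  headCoeff k τ • x + stepCos (τ - k + 1) • shiftSeq a k + stepSin (τ - k) • a k

/-- The inserted vector of `insertSeq`, recovered from the positions `n, n + 1, n + 2`. -/
noncomputable def extractHead (n : ℕ) (τ : ℝ) (u : ℕ → Y) : Y :=
  ∑ i ∈ Finset.range 3, headCoeff (n + i) τ • u (n + i)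

/-- The sequence that `insertSeq` rotates, recovered from the result. -/
noncomputable def extractSeq (τ : ℝ) (u : ℕ → Y) (k : ℕ) : Y :=
  stepSin (τ - k) • u k + stepCos (τ - k) • u (k + 1)

theorem insertSeq_of_lt {τ : ℝ} {k : ℕ} (h : (k : ℝ) + 1 ≤ τ) (x : Y) (a : ℕ → Y) :
    insertSeq τ x a k = a k := by
  rw [insertSeq, headCoeff_of_add_one_le h, stepCos_of_one_le (by linarith),
    stepSin_of_one_le (by linarith)]
  simp

theorem insertSeq_of_gt {τ : ℝ} {k : ℕ} (h : τ ≤ k) (x : Y) (a : ℕ → Y) :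
    insertSeq τ x a (k + 1) = a k := by
  rw [insertSeq, headCoeff_of_le_sub_one (by push_cast; linarith), stepCos_of_nonpos
    (by push_cast; linarith), stepSin_of_nonpos (by push_cast; linarith)]
  simp [shiftSeq]

theorem extractSeq_of_lt {τ : ℝ} {k : ℕ} (h : (k : ℝ) + 1 ≤ τ) (u : ℕ → Y) :
    extractSeq τ u k = u k := by
  rw [extractSeq, stepCos_of_one_le (by linarith), stepSin_of_one_le (by linarith)]
  simp

theorem extractSeq_of_gt {τ : ℝ} {k : ℕ} (h : τ ≤ k) (u : ℕ → Y) :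
    extractSeq τ u k = u (k + 1) := by
  rw [extractSeq, stepCos_of_nonpos (by linarith), stepSin_of_nonpos (by linarith)]
  simp

theorem headCoeff_self {τ : ℝ} {n : ℕ} (h : (n : ℝ) ≤ τ) :
    headCoeff n τ = (-1) ^ n * stepCos (τ - n) := by
  rw [headCoeff, stepSin_of_one_le (by linarith), one_mul]

theorem headCoeff_add_one {τ : ℝ} {n : ℕ} (h : τ ≤ n + 1) :
    headCoeff (n + 1) τ = -((-1) ^ n * stepSin (τ - n)) := by
  rw [headCoeff, stepCos_of_nonpos (by push_cast; linarith), pow_succ]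
  push_cast
  ring_nf

theorem extractHead_eq {τ : ℝ} {n : ℕ} (h1 : (n : ℝ) ≤ τ) (h2 : τ ≤ n + 1) (u : ℕ → Y) :
    extractHead n τ u
      = ((-1) ^ n * stepCos (τ - n)) • u n - ((-1) ^ n * stepSin (τ - n)) • u (n + 1) := by
  rw [extractHead, Finset.sum_range_succ, Finset.sum_range_succ, Finset.sum_range_one, add_zero,
    headCoeff_self h1, headCoeff_add_one h2,
    headCoeff_of_le_sub_one (k := n + 2) (by push_cast; linarith)]
  simp [sub_eq_add_neg]

theorem insertSeq_self {τ : ℝ} {n : ℕ} (h : (n : ℝ) ≤ τ) (x : Y) (a : ℕ → Y) :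
    insertSeq τ x a n = ((-1) ^ n * stepCos (τ - n)) • x + stepSin (τ - n) • a n := by
  rw [insertSeq, headCoeff_self h, stepCos_of_one_le (u := τ - n + 1) (by linarith)]
  simp

theorem insertSeq_add_one {τ : ℝ} {n : ℕ} (h : τ ≤ n + 1) (x : Y) (a : ℕ → Y) :
    insertSeq τ x a (n + 1) = -((-1) ^ n * stepSin (τ - n)) • x + stepCos (τ - n) • a n := by
  rw [insertSeq, headCoeff_add_one h,
    stepSin_of_nonpos (u := τ - (n + 1 : ℕ)) (by push_cast; linarith),
    show τ - ((n + 1 : ℕ) : ℝ) + 1 = τ - n by push_cast; ring]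
  simp [shiftSeq]

theorem extractHead_insertSeq {τ : ℝ} {n : ℕ} (h1 : (n : ℝ) ≤ τ) (h2 : τ ≤ n + 1) (x : Y)
    (a : ℕ → Y) : extractHead n τ (insertSeq τ x a) = x := by
  rw [extractHead_eq h1 h2, insertSeq_self h1, insertSeq_add_one h2]
  have h := stepSin_sq_add_stepCos_sq (τ - n)
  have e : ((-1 : ℝ) ^ n) * (-1) ^ n = 1 := by rw [← mul_pow]; simp
  match_scalars
  · linear_combination
      e * (stepSin (τ - n) * stepSin (τ - n) + stepCos (τ - n) * stepCos (τ - n)) + h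
  · ring

theorem extractSeq_insertSeq {τ : ℝ} {n : ℕ} (h1 : (n : ℝ) ≤ τ) (h2 : τ ≤ n + 1) (x : Y)
    (a : ℕ → Y) : extractSeq τ (insertSeq τ x a) = a := by
  funext k
  rcases lt_trichotomy k n with hk | rfl | hk
  · have : (k : ℝ) + 1 ≤ n := by exact_mod_cast hk
    rw [extractSeq_of_lt (this.trans h1), insertSeq_of_lt (this.trans h1)]
  · rw [extractSeq, insertSeq_self h1, insertSeq_add_one h2]
    have h := stepSin_sq_add_stepCos_sq (τ - k)
    match_scalars
    · ring
    · linear_combination h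
  · have : (n : ℝ) + 1 ≤ k := by exact_mod_cast hk
    rw [extractSeq_of_gt (h2.trans this), insertSeq_of_gt (h2.trans this)]

theorem insertSeq_extract {τ : ℝ} {n : ℕ} (h1 : (n : ℝ) ≤ τ) (h2 : τ ≤ n + 1) (u : ℕ → Y) :
    insertSeq τ (extractHead n τ u) (extractSeq τ u) = u := by
  have h := stepSin_sq_add_stepCos_sq (τ - n)
  have e : ((-1 : ℝ) ^ n) * (-1) ^ n = 1 := by rw [← mul_pow]; simp
  funext k
  rcases lt_or_ge k n with hk | hk
  · have : (k : ℝ) + 1 ≤ n := by exact_mod_cast hk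
    rw [insertSeq_of_lt (this.trans h1), extractSeq_of_lt (this.trans h1)]
  rcases hk.eq_or_lt with rfl | hk
  · rw [insertSeq_self h1, extractHead_eq h1 h2, extractSeq]
    match_scalars
    · linear_combination e * (stepCos (τ - n) * stepCos (τ - n)) + h
    · linear_combination -e * (stepCos (τ - n) * stepSin (τ - n))
  obtain ⟨k, rfl⟩ := Nat.exists_eq_add_of_lt hk
  rcases k with _ | k
  · rw [add_zero, insertSeq_add_one h2, extractHead_eq h1 h2, extractSeq]
    match_scalars
    · linear_combination -e * (stepCos (τ - n) * stepSin (τ - n))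
    · linear_combination e * (stepSin (τ - n) * stepSin (τ - n)) + h
  · have hτ : τ ≤ ((n + (k + 1) : ℕ) : ℝ) := by
      push_cast; linarith [k.cast_nonneg (α := ℝ)]
    rw [insertSeq_of_gt hτ, extractSeq_of_gt hτ]

theorem extractHead_floor {τ : ℝ} {n : ℕ} (h1 : (n : ℝ) ≤ τ) (h2 : τ < n + 2) (u : ℕ → Y) :
    extractHead ⌊τ⌋₊ τ u = extractHead n τ u := by
  have hτ : 0 ≤ τ := n.cast_nonneg.trans h1
  rcases lt_or_ge τ (n + 1) with h | h
  · rw [(Nat.floor_eq_iff hτ).2 ⟨h1, h⟩]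
  · rw [(Nat.floor_eq_iff (n := n + 1) hτ).2 ⟨by push_cast; linarith, by push_cast; linarith⟩,
      extractHead_eq (by push_cast; linarith) (by push_cast; linarith), extractHead,
      Finset.sum_range_succ, Finset.sum_range_succ, Finset.sum_range_one, add_zero,
      headCoeff_of_add_one_le h, headCoeff_self (n := n + 1) (by push_cast; linarith),
      headCoeff_add_one (n := n + 1) (by push_cast; linarith)]
    simp [sub_eq_add_neg]

theorem insertSeq_smul (τ c : ℝ) (x : Y) (a : ℕ → Y) (k : ℕ) :
    insertSeq τ (c • x) (fun k => c • a k) k = c • insertSeq τ x a k := by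
  cases k <;> simp only [insertSeq, shiftSeq] <;> module

theorem norm_insertSeq_le {τ : ℝ} {n : ℕ} (h1 : (n : ℝ) ≤ τ) (h2 : τ ≤ n + 2) (x : Y)
    (a : ℕ → Y) {ψ : ℕ → ℝ} (hψ0 : ∀ k, 0 ≤ ψ k) (hψ : ∀ k, n ≤ k → k ≤ n + 2 → ψ k = 1) (k : ℕ) :
    ‖insertSeq τ x a k‖ ≤ ‖x‖ * ψ k + ‖shiftSeq a k‖ + ‖a k‖ := by
  have e1 : ‖headCoeff k τ • x‖ ≤ ‖x‖ * ψ k := by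
    by_cases hk : n ≤ k ∧ k ≤ n + 2
    · rw [hψ k hk.1 hk.2, norm_smul, mul_one]
      exact mul_le_of_le_one_left (norm_nonneg _) (abs_headCoeff_le _ _)
    · have : headCoeff k τ = 0 := by
        rw [not_and_or, not_le, not_le] at hk
        rcases hk with hk | hk
        · have : (k : ℝ) + 1 ≤ n := by exact_mod_cast hk
          exact headCoeff_of_add_one_le (by linarith)
        · have : (n : ℝ) + 2 + 1 ≤ k := by exact_mod_cast hk
          exact headCoeff_of_le_sub_one (by linarith)
      rw [this, zero_smul, norm_zero]
      exact mul_nonneg (norm_nonneg _) (hψ0 k)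
  refine norm_add₃_le.trans (add_le_add (add_le_add e1 ?_) ?_) <;> rw [norm_smul]
  · exact mul_le_of_le_one_left (norm_nonneg _) (abs_stepCos_le _)
  · exact mul_le_of_le_one_left (norm_nonneg _) (abs_stepSin_le _)

theorem norm_extractSeq_le (τ : ℝ) (u : ℕ → Y) (k : ℕ) :
    ‖extractSeq τ u k‖ ≤ ‖u k‖ + ‖u (k + 1)‖ := by
  refine (norm_add_le _ _).trans (add_le_add ?_ ?_) <;> rw [norm_smul]
  · exact mul_le_of_le_one_left (norm_nonneg _) (abs_stepSin_le _)
  · exact mul_le_of_le_one_left (norm_nonneg _) (abs_stepCos_le _)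

end Rotation

section Equiv
variable {Y : Type*} [NormedAddCommGroup Y] [NormedSpace ℝ Y] {X : ℕ → Type*}
  [∀ k, NormedAddCommGroup (X k)] {q : ℝ≥0∞} [Fact (1 ≤ q)]

theorem exists_insertEquiv (hq : 0 < q.toReal) (m : ∀ k, X k ≃ Y) (hn : ∀ k x, ‖m k x‖ = ‖x‖)
    {τ : ℝ} (hτ : 0 ≤ τ) :
    ∃ e : (Y × lp X q) ≃ lp X q,
      (∀ z k, e z k = (m k).symm (insertSeq τ z.1 (fun k => m k (z.2 k)) k)) ∧
      (∀ w, (e.symm w).1 = extractHead ⌊τ⌋₊ τ fun k => m k (w k)) ∧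
      (∀ w k, (e.symm w).2 k = (m k).symm (extractSeq τ (fun k => m k (w k)) k)) ∧
      (∀ z, ‖e z‖ ≤ 5 * ‖z‖) ∧ ∀ w, ‖e.symm w‖ ≤ 5 * ‖w‖ := by
  have h1 := Nat.floor_le hτ
  have h2 := (Nat.lt_floor_add_one τ).le
  have hn' : ∀ k y, ‖(m k).symm y‖ = ‖y‖ := fun k y => by rw [← hn, Equiv.apply_symm_apply]
  have hfwd : ∀ z : Y × lp X q, ∃ g : lp X q,
      (∀ k, g k = (m k).symm (insertSeq τ z.1 (fun k => m k (z.2 k)) k)) ∧ ‖g‖ ≤ 5 * ‖z‖ := by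
    rintro ⟨x, s⟩
    obtain ⟨ψ, hψ0, hψ, hψn⟩ := exists_window (q := q) ⌊τ⌋₊
    obtain ⟨f, hf0, hf, hfn⟩ := exists_shift hq (normSeq s)
    obtain ⟨g, hg, hgn⟩ := exists_lp_norm_le hq (E := X) (F := ‖x‖ • ψ + f + normSeq s)
      (b := fun k => (m k).symm (insertSeq τ x (fun k => m k (s k)) k)) (fun k => by
        rw [hn']
        refine (norm_insertSeq_le h1 (h2.trans (by linarith)) x _ hψ0 hψ k).trans_eq ?_
        change _ = ‖x‖ * ψ k + f k + ‖s k‖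
        rw [hn]
        cases k <;> simp [shiftSeq, hf0, hf, hn])
    refine ⟨g, hg, hgn.trans (norm_add₃_le.trans ?_)⟩
    rw [norm_smul, norm_norm]
    have hx : ‖x‖ ≤ ‖(x, s)‖ := norm_fst_le (x, s)
    have hs : ‖s‖ ≤ ‖(x, s)‖ := norm_snd_le (x, s)
    rw [norm_normSeq hq] at hfn ⊢
    nlinarith [norm_nonneg x]
  have hbwd : ∀ w : lp X q, ∃ g : lp X q,
      (∀ k, g k = (m k).symm (extractSeq τ (fun k => m k (w k)) k)) ∧ ‖g‖ ≤ 5 * ‖w‖ := by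
    intro w
    obtain ⟨f, hf, hfn⟩ := exists_backshift hq (normSeq w)
    obtain ⟨g, hg, hgn⟩ := exists_lp_norm_le hq (E := X) (F := normSeq w + f)
      (b := fun k => (m k).symm (extractSeq τ (fun k => m k (w k)) k)) (fun k => by
        rw [hn']
        refine (norm_extractSeq_le _ _ _).trans_eq ?_
        rw [hn, hn, lp.coeFn_add, Pi.add_apply, hf]
        rfl)
    refine ⟨g, hg, hgn.trans ((norm_add_le _ _).trans ?_)⟩
    rw [norm_normSeq hq] at hfn ⊢
    linarith [norm_nonneg w]
  have hhead : ∀ w : lp X q, ‖extractHead ⌊τ⌋₊ τ fun k => m k (w k)‖ ≤ 5 * ‖w‖ := by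
    intro w
    refine (norm_sum_le _ _).trans ((Finset.sum_le_card_nsmul _ _ ‖w‖ fun i _ => ?_).trans ?_)
    · rw [norm_smul, hn]
      exact (mul_le_of_le_one_left (norm_nonneg _) (abs_headCoeff_le _ _)).trans
        (lp.norm_apply_le_norm (one_pos.trans_le Fact.out).ne' _ _)
    · rw [Finset.card_range, nsmul_eq_mul]
      push_cast
      linarith [norm_nonneg w]
  choose F hF hFn using hfwd
  choose G hG hGn using hbwd
  refine ⟨{ toFun := F
            invFun := fun w => (extractHead ⌊τ⌋₊ τ fun k => m k (w k), G w)
            left_inv := fun z => ?_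
            right_inv := fun w => ?_ }, hF, fun w => rfl, hG, hFn, fun w => ?_⟩
  · refine Prod.ext ?_ (lp.ext (funext fun k => ?_))
    · simp only [hF, Equiv.apply_symm_apply]
      exact extractHead_insertSeq h1 h2 _ _
    · simp only [hG, hF, Equiv.apply_symm_apply]
      rw [Equiv.symm_apply_eq]
      exact congrFun (extractSeq_insertSeq h1 h2 z.1 fun k => m k (z.2 k)) k
  · refine lp.ext (funext fun k => ?_)
    simp only [hF, hG, Equiv.apply_symm_apply]
    rw [Equiv.symm_apply_eq]
    exact congrFun (insertSeq_extract h1 h2 fun k => m k (w k)) k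
  · exact norm_prod_le_iff.2 ⟨hhead w, hGn w⟩

end Equiv

theorem rpow_mul_rpow_le_of_le {d ρ θ η : ℝ} (hd : 0 ≤ d) (hdρ : d ≤ ρ) (hθ0 : 0 ≤ θ)
    (hθη : θ ≤ η) (hη1 : η ≤ 1) : d ^ η * ρ ^ (1 - η) ≤ d ^ θ * ρ ^ (1 - θ) := by
  have hρ := hd.trans hdρ
  have h1 : d ^ η = d ^ θ * d ^ (η - θ) := by
    rw [← Real.rpow_add_of_nonneg hd hθ0 (by linarith), add_sub_cancel]
  have h2 : ρ ^ (1 - θ) = ρ ^ (η - θ) * ρ ^ (1 - η) := by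
    rw [← Real.rpow_add_of_nonneg hρ (by linarith) (by linarith)]; ring_nf
  rw [h1, h2, mul_assoc]
  gcongr

theorem HomHolder.of_le {A B : Type*} [NormedAddCommGroup A] [NormedAddCommGroup B] {C θ η : ℝ}
    {f : A → B} (hf : HomHolder C η f) (hC : 0 ≤ C) (hθ0 : 0 ≤ θ) (hθη : θ ≤ η) (hη1 : η ≤ 1) :
    HomHolder C θ f := fun x y => by
  refine (hf x y).trans ?_
  rw [mul_assoc, mul_assoc]
  exact mul_le_mul_of_nonneg_left
    (rpow_mul_rpow_le_of_le (norm_nonneg _) (norm_sub_le x y) hθ0 hθη hη1) hC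

section Pointwise
variable {Y : Type*} [NormedAddCommGroup Y] [NormedSpace ℝ Y]

theorem norm_smul_sub_smul_le {c c' δ : ℝ} (hc : |c| ≤ 1) (hδ : 0 ≤ δ) (hcc : |c - c'| ≤ 4 * δ)
    (a a' : Y) : ‖c • a - c' • a'‖ ≤ 4 * δ * (‖a‖ + ‖a'‖) + ‖a - a'‖ := by
  have e : c • a - c' • a' = (c - c') • a' + c • (a - a') := by module
  rw [e]
  refine (norm_add_le _ _).trans (add_le_add ?_ ?_) <;> rw [norm_smul, Real.norm_eq_abs]
  · exact mul_le_mul hcc (le_add_of_nonneg_left (norm_nonneg _)) (norm_nonneg _) (by positivity)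
  · exact mul_le_of_le_one_left (norm_nonneg _) hc

theorem norm_stepSin_smul_sub_le (τ τ' : ℝ) (k : ℕ) (a a' : Y) :
    ‖stepSin (τ - k) • a - stepSin (τ' - k) • a'‖ ≤ 4 * |τ - τ'| * (‖a‖ + ‖a'‖) + ‖a - a'‖ := by
  refine norm_smul_sub_smul_le (abs_stepSin_le _) (abs_nonneg _)
    ((abs_stepSin_sub_le _ _).trans ?_) a a'
  rw [sub_sub_sub_cancel_right]
  linarith [abs_nonneg (τ - τ')]

theorem norm_stepCos_smul_sub_le {u v τ τ' : ℝ} (h : u - v = τ - τ') (a a' : Y) :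
    ‖stepCos u • a - stepCos v • a'‖ ≤ 4 * |τ - τ'| * (‖a‖ + ‖a'‖) + ‖a - a'‖ := by
  refine norm_smul_sub_smul_le (abs_stepCos_le _) (abs_nonneg _)
    ((abs_stepCos_sub_le _ _).trans ?_) a a'
  rw [h]
  linarith [abs_nonneg (τ - τ')]

theorem norm_insertSeq_sub_le {τ τ' : ℝ} {n k : ℕ} (h1 : (n : ℝ) ≤ τ) (h1' : (n : ℝ) ≤ τ')
    (h2 : τ ≤ n + 2) (h2' : τ' ≤ n + 2) (hk : n ≤ k) (x x' : Y) (a a' : ℕ → Y) {ψ f g : ℕ → ℝ}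
    (hψ0 : ∀ k, 0 ≤ ψ k) (hψ : ∀ k, n ≤ k → k ≤ n + 2 → ψ k = 1)
    (hf0 : f 0 = 0) (hf : ∀ k, f (k + 1) = g k) (hg0 : ∀ k, 0 ≤ g k)
    (hg : ∀ k, n ≤ k → 4 * |τ - τ'| * (‖a k‖ + ‖a' k‖) + ‖a k - a' k‖ ≤ g k) :
    ‖insertSeq τ x a k - insertSeq τ' x' a' k‖
      ≤ (4 * |τ - τ'| * (‖x‖ + ‖x'‖) + ‖x - x'‖) * ψ k + f k + g k := by
  have e1 : ‖headCoeff k τ • x - headCoeff k τ' • x'‖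
      ≤ (4 * |τ - τ'| * (‖x‖ + ‖x'‖) + ‖x - x'‖) * ψ k := by
    by_cases hk2 : k ≤ n + 2
    · rw [hψ k hk hk2, mul_one]
      exact norm_smul_sub_smul_le (abs_headCoeff_le _ _) (abs_nonneg _)
        (abs_headCoeff_sub_le _ _ _) _ _
    · have h3 : (n : ℝ) + 2 + 1 ≤ k := by exact_mod_cast not_le.1 hk2
      rw [headCoeff_of_le_sub_one (by linarith), headCoeff_of_le_sub_one (by linarith), zero_smul,
        zero_smul, sub_zero, norm_zero]
      have := hψ0 k
      positivity
  have e2 : ‖stepCos (τ - k + 1) • shiftSeq a k - stepCos (τ' - k + 1) • shiftSeq a' k‖ ≤ f k := by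
    rcases hk.eq_or_lt with rfl | hk
    · rw [stepCos_of_one_le (by linarith), stepCos_of_one_le (by linarith), zero_smul, zero_smul,
        sub_zero, norm_zero]
      cases n with
      | zero => exact hf0.ge
      | succ n => exact (hf n).symm ▸ hg0 n
    · obtain ⟨j, rfl⟩ : ∃ j, k = j + 1 := ⟨k - 1, by omega⟩
      rw [hf]
      exact (norm_stepCos_smul_sub_le (by ring) _ _).trans (hg j (by omega))
  have e3 := (norm_stepSin_smul_sub_le τ τ' k (a k) (a' k)).trans (hg k hk)
  have e : insertSeq τ x a k - insertSeq τ' x' a' k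
      = (headCoeff k τ • x - headCoeff k τ' • x')
        + (stepCos (τ - k + 1) • shiftSeq a k - stepCos (τ' - k + 1) • shiftSeq a' k)
        + (stepSin (τ - k) • a k - stepSin (τ' - k) • a' k) := by
    simp only [insertSeq]; abel
  rw [e]
  exact norm_add₃_le.trans (by linarith)

theorem norm_extractSeq_sub_le (τ τ' : ℝ) {k : ℕ} (u u' : ℕ → Y) {g : ℕ → ℝ}
    (hg : ∀ i, k ≤ i → 4 * |τ - τ'| * (‖u i‖ + ‖u' i‖) + ‖u i - u' i‖ ≤ g i) :
    ‖extractSeq τ u k - extractSeq τ' u' k‖ ≤ g k + g (k + 1) := by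
  have e : extractSeq τ u k - extractSeq τ' u' k
      = (stepSin (τ - k) • u k - stepSin (τ' - k) • u' k)
        + (stepCos (τ - k) • u (k + 1) - stepCos (τ' - k) • u' (k + 1)) := by
    simp only [extractSeq]; abel
  rw [e]
  exact (norm_add_le _ _).trans (add_le_add
    ((norm_stepSin_smul_sub_le _ _ _ _ _).trans (hg k le_rfl))
    ((norm_stepCos_smul_sub_le (by ring) _ _).trans (hg _ (by omega))))

theorem norm_extractHead_sub_le (τ τ' : ℝ) {n : ℕ} (u u' : ℕ → Y) {M : ℝ}
    (hM : ∀ i, n ≤ i → 4 * |τ - τ'| * (‖u i‖ + ‖u' i‖) + ‖u i - u' i‖ ≤ M) :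
    ‖extractHead n τ u - extractHead n τ' u'‖ ≤ 3 * M := by
  rw [extractHead, extractHead, ← Finset.sum_sub_distrib]
  refine (norm_sum_le _ _).trans ((Finset.sum_le_card_nsmul _ _ M fun i _ => ?_).trans_eq ?_)
  · exact (norm_smul_sub_smul_le (abs_headCoeff_le _ _) (abs_nonneg _)
      (abs_headCoeff_sub_le _ _ _) _ _).trans (hM _ (by omega))
  · simp

end Pointwise

section Estimates
variable {X : ℕ → Type*} [∀ k, NormedAddCommGroup (X k)] {q : ℝ≥0∞} [Fact (1 ≤ q)]

theorem norm_sub_le_of_rpow {w w' : lp X q} {F P : lp (fun _ : ℕ => ℝ) q} (hq : 0 < q.toReal)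
    (hF : ∀ k, 0 ≤ F k) (hP : ∀ k, 0 ≤ P k) {C θ D N : ℝ} (hC : 1 ≤ C) (hθ0 : 0 ≤ θ)
    (hθ1 : θ ≤ 1) (hD : 0 ≤ D) (hN : 0 ≤ N)
    (h : ∀ k, ‖w k - w' k‖ ≤ C * F k ^ θ * P k ^ (1 - θ))
    (hFn : ‖F‖ ≤ 45 * C * (D ^ θ * N ^ (1 - θ))) (hPn : ‖P‖ ≤ 5 * N) :
    ‖w - w'‖ ≤ 225 * C ^ 2 * D ^ (θ * θ) * N ^ (1 - θ * θ) := by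
  obtain ⟨g, hg, hgn⟩ := exists_lp_norm_le_rpow_mul_rpow (a := 1) hq hq (one_mul _) hθ0 hθ1
    (zero_le_one.trans hC) hF hP h
  have e : w - w' = g := lp.ext (funext fun k => by rw [hg, lp.coeFn_sub, Pi.sub_apply])
  have one_le_pow : ∀ {c t : ℝ}, 1 ≤ c → t ≤ 1 → c ^ t ≤ c := fun hc ht => by
    simpa using Real.rpow_le_rpow_of_exponent_le hc ht
  have h1 : ‖F‖ ^ θ ≤ 45 * C * (D ^ (θ * θ) * N ^ ((1 - θ) * θ)) := by
    calc ‖F‖ ^ θ ≤ (45 * C * (D ^ θ * N ^ (1 - θ))) ^ θ := by gcongr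
      _ = (45 * C) ^ θ * (D ^ (θ * θ) * N ^ ((1 - θ) * θ)) := by
        rw [Real.mul_rpow (x := 45 * C) (by positivity) (by positivity),
          Real.mul_rpow (x := D ^ θ) (by positivity) (by positivity), ← Real.rpow_mul hD,
          ← Real.rpow_mul hN]
      _ ≤ _ := by
        gcongr
        exact one_le_pow (by linarith) hθ1
  have h2 : ‖P‖ ^ (1 - θ) ≤ 5 * N ^ (1 - θ) := by
    calc ‖P‖ ^ (1 - θ) ≤ (5 * N) ^ (1 - θ) := by gcongr
      _ = 5 ^ (1 - θ) * N ^ (1 - θ) := Real.mul_rpow (by norm_num) hN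
      _ ≤ _ := by
        gcongr
        exact one_le_pow (by norm_num) (by linarith)
  rw [e]
  calc ‖g‖ ≤ C * ‖F‖ ^ θ * ‖P‖ ^ (1 - θ) := hgn
    _ ≤ C * (45 * C * (D ^ (θ * θ) * N ^ ((1 - θ) * θ))) * (5 * N ^ (1 - θ)) := by gcongr
    _ = 225 * C ^ 2 * D ^ (θ * θ) * (N ^ ((1 - θ) * θ) * N ^ (1 - θ)) := by ring
    _ = _ := by
      rw [← Real.rpow_add_of_nonneg hN (mul_nonneg (by linarith) hθ0) (by linarith)]
      ring_nf

variable {Y : Type*} [NormedAddCommGroup Y]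

theorem exists_lp_bounds (hq : 0 < q.toReal) {m : ∀ k, X k ≃ Y} (hn : ∀ k x, ‖m k x‖ = ‖x‖)
    {C : ℝ} (hC : 1 ≤ C) (hm : ∀ k, HomHolder C (expo k) (m k)) (n : ℕ) {δ D N : ℝ} (hδ : 0 ≤ δ)
    {s s' : lp X q} (hD : ‖s - s'‖ ≤ D) (hN : ‖s‖ + ‖s'‖ ≤ N) (hDN : D ≤ N)
    (hδN : δ * N ≤ 2 * D) :
    ∃ r G : lp (fun _ : ℕ => ℝ) q, (∀ k, r k = ‖s k‖ + ‖s' k‖) ∧ (∀ k, 0 ≤ G k) ∧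
      (∀ k, ‖s k - s' k‖ ≤ G k) ∧
      (∀ k, n ≤ k → 4 * δ * (‖m k (s k)‖ + ‖m k (s' k)‖) + ‖m k (s k) - m k (s' k)‖ ≤ G k) ∧
      ‖r‖ ≤ N ∧ ‖G‖ ≤ 9 * C * (D ^ expo n * N ^ (1 - expo n)) := by
  have hC0 : 0 ≤ C := zero_le_one.trans hC
  have hD0 : 0 ≤ D := (norm_nonneg _).trans hD
  have hθ0 := expo_nonneg n
  have hθ1 := (expo_lt_one n).le
  have hr : ‖normSeq s + normSeq s'‖ ≤ N :=
    (norm_add_le _ _).trans (by rwa [norm_normSeq hq, norm_normSeq hq])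
  have hr0 : ∀ k, 0 ≤ (normSeq s + normSeq s') k := fun k =>
    add_nonneg (norm_nonneg (s k)) (norm_nonneg (s' k))
  have hle : ∀ k, ‖s k - s' k‖
      ≤ C * ‖s k - s' k‖ ^ expo n * (‖s k‖ + ‖s' k‖) ^ (1 - expo n) := fun k => by
    have := le_rpow_mul_rpow (norm_nonneg _) (norm_sub_le (s k) (s' k)) hθ0 hθ1
    rw [mul_assoc]
    exact this.trans (le_mul_of_one_le_left (by positivity) hC)
  obtain ⟨H, hH, hHn⟩ := exists_lp_norm_le_rpow_mul_rpow (E := fun _ => ℝ) (a := 1) hq hq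
    (one_mul _) hθ0 hθ1 hC0 (F := normSeq (s - s')) (P := normSeq s + normSeq s')
    (fun k => norm_nonneg _) hr0
    (b := fun k => C * ‖s k - s' k‖ ^ expo n * (‖s k‖ + ‖s' k‖) ^ (1 - expo n)) (fun k => by
      rw [Real.norm_of_nonneg (by positivity)]; rfl)
  have hH0 : ∀ k, 0 ≤ H k := fun k => by rw [hH]; positivity
  have hG : ∀ k, ((4 * δ) • (normSeq s + normSeq s') + H) k = 4 * δ * (‖s k‖ + ‖s' k‖) + H k :=
    fun k => rfl
  refine ⟨normSeq s + normSeq s', (4 * δ) • (normSeq s + normSeq s') + H, fun k => rfl,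
    fun k => ?_, fun k => ?_, fun k hk => ?_, hr, ?_⟩
  · have := hH0 k
    rw [hG]; positivity
  · rw [hG, hH]
    have : 0 ≤ 4 * δ * (‖s k‖ + ‖s' k‖) := by positivity
    linarith [hle k]
  · rw [hG, hH, hn, hn]
    exact add_le_add le_rfl ((hm k).of_le hC0 hθ0 (expo_mono hk) (expo_lt_one k).le _ _)
  · have hE := le_rpow_mul_rpow hD0 hDN hθ0 hθ1
    have h1 : ‖H‖ ≤ C * (D ^ expo n * N ^ (1 - expo n)) := by
      rw [norm_normSeq hq, mul_assoc] at hHn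
      refine hHn.trans ?_
      have : 0 ≤ 1 - expo n := by linarith
      gcongr
    have h2 : ‖(4 * δ) • (normSeq s + normSeq s')‖ ≤ 8 * D := by
      rw [norm_smul, Real.norm_of_nonneg (by positivity)]
      nlinarith
    have h3 : 8 * D ≤ 8 * C * (D ^ expo n * N ^ (1 - expo n)) := by
      nlinarith
    exact (norm_add_le _ _).trans (by linarith)

theorem norm_sub_le_rpow_mul_rpow {A : Type*} [NormedAddCommGroup A] {v v' : A} {C θ F P : ℝ}
    (hC : 1 ≤ C) (hθ0 : 0 ≤ θ) (hθ1 : θ ≤ 1) (hF : ‖v - v'‖ ≤ F) (hP : ‖v‖ + ‖v'‖ ≤ P) :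
    ‖v - v'‖ ≤ C * F ^ θ * P ^ (1 - θ) := by
  have hF0 := (norm_nonneg _).trans hF
  have hP0 : 0 ≤ P := le_trans (by positivity) hP
  have : 0 ≤ 1 - θ := by linarith
  calc ‖v - v'‖ ≤ ‖v - v'‖ ^ θ * (‖v‖ + ‖v'‖) ^ (1 - θ) :=
        le_rpow_mul_rpow (norm_nonneg _) (norm_sub_le v v') hθ0 hθ1
    _ ≤ F ^ θ * P ^ (1 - θ) := by gcongr
    _ ≤ C * (F ^ θ * P ^ (1 - θ)) := le_mul_of_one_le_left (by positivity) hC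
    _ = _ := by ring

theorem HomHolder.norm_sub_le {A B : Type*} [NormedAddCommGroup A] [NormedAddCommGroup B]
    {f : A → B} {C : ℝ} {n k : ℕ} (hf : HomHolder C (expo k) f) (hC : 0 ≤ C) (hk : n ≤ k)
    {u u' : A} {F P : ℝ} (hF : ‖u - u'‖ ≤ F) (hP : ‖u‖ + ‖u'‖ ≤ P) :
    ‖f u - f u'‖ ≤ C * F ^ expo n * P ^ (1 - expo n) := by
  have h0 := expo_nonneg n
  have hF0 := (norm_nonneg _).trans hF
  have : 0 ≤ 1 - expo n := by linarith [expo_lt_one n]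
  refine (hf.of_le hC h0 (expo_mono hk) (expo_lt_one k).le u u').trans ?_
  gcongr

variable [NormedSpace ℝ Y]

theorem norm_sub_le_of_insertSeq (hq : 0 < q.toReal) {m : ∀ k, X k ≃ Y}
    (hn : ∀ k x, ‖m k x‖ = ‖x‖) {C : ℝ} (hC : 1 ≤ C) (hm : ∀ k, HomHolder C (expo k) (m k))
    (hm' : ∀ k, HomHolder C (expo k) (m k).symm) {n : ℕ} {τ τ' : ℝ}
    (h1 : (n : ℝ) ≤ τ) (h1' : (n : ℝ) ≤ τ') (h2 : τ ≤ n + 2) (h2' : τ' ≤ n + 2)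
    {x x' : Y} {s s' w w' : lp X q} {D N : ℝ} (hxD : ‖x - x'‖ ≤ D) (hsD : ‖s - s'‖ ≤ D)
    (hxN : ‖x‖ + ‖x'‖ ≤ N) (hsN : ‖s‖ + ‖s'‖ ≤ N) (hDN : D ≤ N) (hδN : |τ - τ'| * N ≤ 2 * D)
    (hw : ∀ k, w k = (m k).symm (insertSeq τ x (fun k => m k (s k)) k))
    (hw' : ∀ k, w' k = (m k).symm (insertSeq τ' x' (fun k => m k (s' k)) k)) :
    ‖w - w'‖ ≤ 225 * C ^ 2 * D ^ (expo n * expo n) * N ^ (1 - expo n * expo n) := by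
  have hC0 : 0 ≤ C := zero_le_one.trans hC
  have hθ1 := (expo_lt_one n).le
  have hD0 : 0 ≤ D := (norm_nonneg _).trans hxD
  have hN0 : 0 ≤ N := hD0.trans hDN
  obtain ⟨r, G, hr, hG0, hG1, hG2, hrn, hGn⟩ := exists_lp_bounds hq hn hC hm n (abs_nonneg _)
    hsD hsN hDN hδN
  have hE := le_rpow_mul_rpow hD0 hDN (expo_nonneg n) hθ1
  obtain ⟨ψ, hψ0, hψ, hψn⟩ := exists_window (q := q) n
  obtain ⟨f, hf0, hf, hfn⟩ := exists_shift hq G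
  obtain ⟨r', hr0', hr', hrn'⟩ := exists_shift hq r
  have hrk : ∀ k, 0 ≤ r k := fun k => by rw [hr]; positivity
  have hfk : ∀ k, 0 ≤ f k
    | 0 => hf0.ge
    | k + 1 => (hf k).symm ▸ hG0 k
  have hrk' : ∀ k, 0 ≤ r' k
    | 0 => hr0'.ge
    | k + 1 => (hr' k).symm ▸ hrk k
  refine norm_sub_le_of_rpow hq
    (F := (4 * |τ - τ'| * (‖x‖ + ‖x'‖) + ‖x - x'‖) • ψ + f + G)
    (P := (‖x‖ + ‖x'‖) • ψ + r' + r) (fun k => ?_) (fun k => ?_) hC (expo_nonneg n)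
    hθ1 hD0 hN0 (fun k => ?_) ?_ ?_
  · change 0 ≤ (4 * |τ - τ'| * (‖x‖ + ‖x'‖) + ‖x - x'‖) * ψ k + f k + G k
    have := hψ0 k; have := hfk k; have := hG0 k
    positivity
  · change 0 ≤ (‖x‖ + ‖x'‖) * ψ k + r' k + r k
    have := hψ0 k; have := hrk' k; have := hrk k
    positivity
  · change _ ≤ C * ((4 * |τ - τ'| * (‖x‖ + ‖x'‖) + ‖x - x'‖) * ψ k + f k + G k) ^ expo n
      * ((‖x‖ + ‖x'‖) * ψ k + r' k + r k) ^ (1 - expo n)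
    rw [hw, hw']
    rcases lt_or_ge k n with hk | hk
    · have hk' : (k : ℝ) + 1 ≤ n := by exact_mod_cast hk
      rw [insertSeq_of_lt (hk'.trans h1), insertSeq_of_lt (hk'.trans h1'),
        Equiv.symm_apply_apply, Equiv.symm_apply_apply]
      have := hψ0 k
      refine norm_sub_le_rpow_mul_rpow hC (expo_nonneg n) hθ1
        ((hG1 k).trans (le_add_of_nonneg_left ?_)) ((hr k).symm.le.trans (le_add_of_nonneg_left ?_))
      · have := hfk k; positivity
      · have := hrk' k; positivity
    · refine (hm' k).norm_sub_le hC0 hk (norm_insertSeq_sub_le h1 h1' h2 h2' hk _ _ _ _ hψ0 hψ hf0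
        hf hG0 hG2) ((add_le_add (norm_insertSeq_le h1 h2 x _ hψ0 hψ k)
          (norm_insertSeq_le h1' h2' x' _ hψ0 hψ k)).trans_eq ?_)
      have e1 : ‖shiftSeq (fun k => m k (s k)) k‖ + ‖shiftSeq (fun k => m k (s' k)) k‖ = r' k := by
        cases k <;> simp [shiftSeq, hr0', hr', hr, hn]
      rw [← e1, hr, hn, hn]
      ring
  · refine norm_add₃_le.trans ?_
    rw [norm_smul, Real.norm_of_nonneg (by positivity)]
    have hc : 4 * |τ - τ'| * (‖x‖ + ‖x'‖) + ‖x - x'‖ ≤ 9 * D := by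
      nlinarith [abs_nonneg (τ - τ')]
    have : (4 * |τ - τ'| * (‖x‖ + ‖x'‖) + ‖x - x'‖) * ‖ψ‖ ≤ 9 * D * 3 := by gcongr
    nlinarith
  · refine norm_add₃_le.trans ?_
    rw [norm_smul, Real.norm_of_nonneg (by positivity)]
    have : (‖x‖ + ‖x'‖) * ‖ψ‖ ≤ N * 3 := by gcongr
    linarith

theorem norm_sub_le_of_extractSeq (hq : 0 < q.toReal) {m : ∀ k, X k ≃ Y}
    (hn : ∀ k x, ‖m k x‖ = ‖x‖) {C : ℝ} (hC : 1 ≤ C) (hm : ∀ k, HomHolder C (expo k) (m k))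
    (hm' : ∀ k, HomHolder C (expo k) (m k).symm) {n : ℕ} {τ τ' : ℝ}
    (h1 : (n : ℝ) ≤ τ) (h1' : (n : ℝ) ≤ τ') {s s' w w' : lp X q} {D N : ℝ} (hsD : ‖s - s'‖ ≤ D)
    (hsN : ‖s‖ + ‖s'‖ ≤ N) (hDN : D ≤ N) (hδN : |τ - τ'| * N ≤ 2 * D)
    (hw : ∀ k, w k = (m k).symm (extractSeq τ (fun k => m k (s k)) k))
    (hw' : ∀ k, w' k = (m k).symm (extractSeq τ' (fun k => m k (s' k)) k)) :
    max ‖extractHead n τ (fun k => m k (s k)) - extractHead n τ' (fun k => m k (s' k))‖ ‖w - w'‖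
      ≤ 225 * C ^ 2 * D ^ (expo n * expo n) * N ^ (1 - expo n * expo n) := by
  have hC0 : 0 ≤ C := zero_le_one.trans hC
  have hθ0 := expo_nonneg n
  have hθ1 := (expo_lt_one n).le
  have hD0 : 0 ≤ D := (norm_nonneg _).trans hsD
  have hN0 : 0 ≤ N := hD0.trans hDN
  obtain ⟨r, G, hr, hG0, hG1, hG2, hrn, hGn⟩ := exists_lp_bounds hq hn hC hm n (abs_nonneg _)
    hsD hsN hDN hδN
  obtain ⟨f, hf, hfn⟩ := exists_backshift hq G
  obtain ⟨r', hr', hrn'⟩ := exists_backshift hq r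
  have hrk : ∀ k, 0 ≤ r k := fun k => by rw [hr]; positivity
  have hfk : ∀ k, 0 ≤ f k := fun k => (hf k).symm ▸ hG0 _
  have hrk' : ∀ k, 0 ≤ r' k := fun k => (hr' k).symm ▸ hrk _
  refine max_le ?_ (norm_sub_le_of_rpow hq (F := G + f) (P := r + r')
    (fun k => add_nonneg (hG0 k) (hfk k)) (fun k => add_nonneg (hrk k) (hrk' k)) hC hθ0
    hθ1 hD0 hN0 (fun k => ?_) ?_ ?_)
  · have hq0 : q ≠ 0 := (one_pos.trans_le Fact.out).ne'
    have hGk : ∀ k, G k ≤ ‖G‖ := fun k => (le_abs_self _).trans (lp.norm_apply_le_norm hq0 G k)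
    refine (norm_extractHead_sub_le τ τ' _ _ fun i hi => (hG2 i hi).trans (hGk i)).trans ?_
    have hE := rpow_mul_rpow_le_of_le (θ := expo n * expo n) hD0 hDN (by positivity)
      (mul_le_of_le_one_left hθ0 hθ1) hθ1
    have hE0 : 0 ≤ D ^ expo n * N ^ (1 - expo n) := by positivity
    calc 3 * ‖G‖ ≤ 27 * C * (D ^ expo n * N ^ (1 - expo n)) := by linarith
      _ ≤ 225 * C ^ 2 * (D ^ (expo n * expo n) * N ^ (1 - expo n * expo n)) :=
          mul_le_mul (by nlinarith) hE hE0 (by positivity)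
      _ = _ := by ring
  · change _ ≤ C * (G k + f k) ^ expo n * (r k + r' k) ^ (1 - expo n)
    rw [hw, hw']
    rcases lt_or_ge k n with hk | hk
    · have hk' : (k : ℝ) + 1 ≤ n := by exact_mod_cast hk
      rw [extractSeq_of_lt (hk'.trans h1), extractSeq_of_lt (hk'.trans h1'),
        Equiv.symm_apply_apply, Equiv.symm_apply_apply]
      exact norm_sub_le_rpow_mul_rpow hC hθ0 hθ1
        ((hG1 k).trans (le_add_of_nonneg_right (hfk k)))
        ((hr k).symm.le.trans (le_add_of_nonneg_right (hrk' k)))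
    · rw [hf, hr', hr, hr]
      refine (hm' k).norm_sub_le hC0 hk
        (norm_extractSeq_sub_le τ τ' _ _ fun i hi => hG2 i (hk.trans hi))
        ((add_le_add (norm_extractSeq_le _ _ _) (norm_extractSeq_le _ _ _)).trans_eq ?_)
      simp only [hn]
      ring
  · have : 0 ≤ C * (D ^ expo n * N ^ (1 - expo n)) := by positivity
    exact (norm_add_le _ _).trans (by linarith)
  · exact (norm_add_le _ _).trans (by linarith)

theorem nonempty_uniformEquiv_prod_lp [∀ k, NormedSpace ℝ (X k)] (hq : 0 < q.toReal)
    (m : ∀ k, X k ≃ Y) (hn : ∀ k x, ‖m k x‖ = ‖x‖)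
    (hh : ∀ k (c : ℝ) x, 0 ≤ c → m k (c • x) = c • m k x) {C : ℝ} (hC : 1 ≤ C)
    (hm : ∀ k, HomHolder C (expo k) (m k)) (hm' : ∀ k, HomHolder C (expo k) (m k).symm) :
    Nonempty ((Y × lp X q) ≃ᵤ lp X q) := by
  have hlog : ∀ r : ℝ, 0 ≤ Real.log (1 + |r|) := fun r =>
    Real.log_nonneg (by linarith [abs_nonneg r])
  choose g hg hg1 hg2 hgn hgn' using fun r : ℝ => exists_insertEquiv hq m hn (hlog r)
  have hh' : ∀ k (c : ℝ) y, 0 ≤ c → (m k).symm (c • y) = c • (m k).symm y := fun k c y hc => by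
    rw [Equiv.symm_apply_eq, hh k c _ hc, Equiv.apply_symm_apply]
  refine nonempty_uniformEquiv_of_homogeneous g (K := 5) (by norm_num) hgn hgn' ?_ ?_ ?_
  · intro r c z hc
    refine lp.ext (funext fun k => ?_)
    rw [lp.coeFn_smul, Pi.smul_apply, hg, hg, ← hh' k c _ hc, ← insertSeq_smul]
    congr 2
    funext j
    exact hh j c _ hc
  · refine uniformContinuous_of_expo (K := 225 * C ^ 2) (by positivity) ?_
    intro n z z' h1 h1' h2 h2' hδN
    refine norm_sub_le_of_insertSeq hq hn hC hm hm' h1 h1' h2.le h2'.le (norm_fst_le (z - z'))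
      (norm_snd_le (z - z')) (add_le_add (norm_fst_le z) (norm_fst_le z'))
      (add_le_add (norm_snd_le z) (norm_snd_le z')) (norm_sub_le _ _) hδN (fun k => ?_)
      fun k => ?_ <;>
    rw [hg, abs_norm]
  · refine uniformContinuous_of_expo (K := 225 * C ^ 2) (by positivity) ?_
    intro n w w' h1 h1' h2 h2' hδN
    rw [Prod.norm_def, Prod.fst_sub, hg1, hg1, abs_norm, abs_norm, extractHead_floor h1 h2,
      extractHead_floor h1' h2']
    refine norm_sub_le_of_extractSeq hq hn hC hm hm' h1 h1' le_rfl le_rfl (norm_sub_le _ _) hδN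
      (fun k => ?_) fun k => ?_ <;>
    rw [hg2, abs_norm]

end Estimates

theorem exists_continuousLinearEquiv_subseq {X : ℕ → Type*} [∀ k, NormedAddCommGroup (X k)]
    [∀ k, NormedSpace ℝ (X k)] {q : ℝ≥0∞} [Fact (1 ≤ q)] (hq : 0 < q.toReal) {φ : ℕ → ℕ}
    (hφ : StrictMono φ) :
    ∃ V : Submodule ℝ (lp X q), Nonempty (lp X q ≃L[ℝ] lp (fun j => X (φ j)) q × V) := by
  have hinj := hφ.injective
  have hR : ∀ s : lp X q, Summable fun j => ‖s (φ j)‖ ^ q.toReal := fun s =>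
    ((lp.memℓp s).summable hq).comp_injective hinj
  let R : lp X q →L[ℝ] lp (fun j => X (φ j)) q := LinearMap.mkContinuous
    { toFun := fun s => ⟨fun j => s (φ j), memℓp_gen (hR s)⟩
      map_add' := fun _ _ => rfl
      map_smul' := fun _ _ => rfl } 1 fun s => by
    rw [one_mul]
    refine lp.norm_le_of_tsum_le hq (norm_nonneg _) ?_
    rw [lp.norm_rpow_eq_tsum hq]
    exact tsum_comp_le_tsum_of_inj ((lp.memℓp s).summable hq) (fun _ => by positivity) hinj
  let E : lp (fun j => X (φ j)) q → ∀ n, X n := fun t n =>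
    ∑ j ∈ Finset.range (n + 1), Pi.single (φ j) (t j) n
  have hE : ∀ t i, E t (φ i) = t i := fun t i => by
    refine (Finset.sum_eq_single i (fun j _ hj => ?_) fun h => ?_).trans (Pi.single_eq_same _ _)
    · exact Pi.single_eq_of_ne (hinj.ne hj.symm) _
    · exact absurd (Finset.mem_range.2 (Nat.lt_succ_of_le (hφ.id_le i))) h
  have hE0 : ∀ t, ∀ n ∉ Set.range φ, E t n = 0 := fun t n hn =>
    Finset.sum_eq_zero fun j _ => Pi.single_eq_of_ne (fun h => hn ⟨j, h.symm⟩) _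
  have hsum : ∀ t, HasSum (fun n => ‖E t n‖ ^ q.toReal) (‖t‖ ^ q.toReal) := fun t => by
    refine (hinj.hasSum_iff fun n hn => ?_).1 ?_
    · rw [hE0 t n hn, norm_zero, Real.zero_rpow hq.ne']
    · simp only [Function.comp_def, hE]
      exact lp.hasSum_norm hq t
  let J : lp (fun j => X (φ j)) q →L[ℝ] lp X q := LinearMap.mkContinuous
    { toFun := fun t => ⟨E t, memℓp_gen (hsum t).summable⟩
      map_add' := fun t t' => lp.ext (funext fun n => by
        change E (t + t') n = E t n + E t' n
        simp only [E, ← Finset.sum_add_distrib]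
        refine Finset.sum_congr rfl fun j _ => ?_
        rw [lp.coeFn_add, Pi.add_apply, Pi.single_add, Pi.add_apply])
      map_smul' := fun c t => lp.ext (funext fun n => by
        change E (c • t) n = c • E t n
        simp only [E, Finset.smul_sum]
        refine Finset.sum_congr rfl fun j _ => ?_
        rw [lp.coeFn_smul, Pi.smul_apply, Pi.single_smul, Pi.smul_apply]) } 1 fun t => by
    rw [one_mul]
    exact lp.norm_le_of_tsum_le hq (norm_nonneg _) (hsum t).tsum_eq.le
  exact ⟨_, ⟨ContinuousLinearEquiv.equivOfRightInverse R J fun t => lp.ext (funext (hE t))⟩⟩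

/-- The norm preserving Mazur map as a bijection. -/
noncomputable def mazurEquiv {r s : ℝ≥0∞} [Fact (1 ≤ r)] [Fact (1 ≤ s)] (hr : 0 < r.toReal)
    (hs : 0 < s.toReal) : lp (fun _ : ℕ => ℝ) r ≃ lp (fun _ : ℕ => ℝ) s where
  toFun := mazurMap r s
  invFun := mazurMap s r
  left_inv := mazurMap_mazurMap hr hs
  right_inv := mazurMap_mazurMap hs hr

theorem exists_strictMono_expo_le {p : ℝ} {pn : ℕ → ℝ} (hp : 0 < p)
    (hlim : Tendsto pn atTop (𝓝 p)) :
    ∃ φ : ℕ → ℕ, StrictMono φ ∧ ∀ j, expo j ≤ pn (φ j) / p ∧ expo j ≤ p / pn (φ j) := by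
  have h1 : Tendsto (fun n => pn n / p) atTop (𝓝 1) := by
    simpa [hp.ne'] using hlim.div_const p
  have h2 : Tendsto (fun n => p / pn n) atTop (𝓝 1) := by
    have h := (tendsto_const_nhds (x := p)).div hlim hp.ne'
    rwa [div_self hp.ne'] at h
  exact extraction_forall_of_eventually fun j =>
    (h1.eventually (eventually_ge_nhds (expo_lt_one j))).and
      (h2.eventually (eventually_ge_nhds (expo_lt_one j)))

end RibeUniform

open RibeUniform

/-- (Ribe, Aharoni–Lindenstrauss) If `1 ≤ p, q, p_n < ∞` and `p_n → p`, then the `q`-sum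
`S = (Σ ⊕ ℓ_{p_n})_q` is uniformly homeomorphic to `ℓ_p ⊕_q S`. -/
theorem ribe_aharoni_lindenstrauss_uniform_homeomorphism
    (p q : ℝ) (pn : ℕ → ℝ) (hp : 1 ≤ p) (hq : 1 ≤ q) (hpn : ∀ n, 1 ≤ pn n)
    (hlim : Tendsto pn atTop (𝓝 p))
    [Fact (1 ≤ ENNReal.ofReal p)] [Fact (1 ≤ ENNReal.ofReal q)]
    [∀ n, Fact (1 ≤ ENNReal.ofReal (pn n))] :
    ∃ f : WithLp (ENNReal.ofReal q)
          ((lp (fun _ : ℕ => ℝ) (ENNReal.ofReal p)) ×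
            (lp (fun n : ℕ => lp (fun _ : ℕ => ℝ) (ENNReal.ofReal (pn n)))
              (ENNReal.ofReal q))) ≃
        lp (fun n : ℕ => lp (fun _ : ℕ => ℝ) (ENNReal.ofReal (pn n))) (ENNReal.ofReal q),
      UniformContinuous f ∧ UniformContinuous f.symm := by
  have hp' : 0 < p := by linarith
  have hpn' : ∀ n, 0 < pn n := fun n => by linarith [hpn n]
  have toReal_pos : ∀ {r : ℝ}, 1 ≤ r → 0 < (ENNReal.ofReal r).toReal := fun hr => by
    rw [ENNReal.toReal_ofReal (by linarith)]; linarith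
  obtain ⟨φ, hφ, hφe⟩ := exists_strictMono_expo_le hp' hlim
  have le_two : ∀ {a b : ℝ} (j : ℕ), 0 < a → 0 < b → expo j ≤ b / a → a / b ≤ 2 := by
    intro a b j ha hb h
    have := (half_le_expo j).trans h
    rw [le_div_iff₀ ha] at this
    rw [div_le_iff₀ hb]
    linarith
  obtain ⟨e⟩ := nonempty_uniformEquiv_prod_lp (q := ENNReal.ofReal q) (C := 17) (toReal_pos hq)
    (fun j => mazurEquiv (toReal_pos (hpn (φ j))) (toReal_pos hp))
    (fun j => norm_mazurMap (toReal_pos (hpn (φ j))) (toReal_pos hp))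
    (fun j c x hc => mazurMap_smul (toReal_pos (hpn (φ j))) (toReal_pos hp) hc x) (by norm_num)
    (fun j => homHolder_mazurMap (toReal_pos (hpn (φ j))) (toReal_pos hp) (expo_nonneg j)
      (expo_lt_one j).le
      (by rw [ENNReal.toReal_ofReal (hpn' _).le, ENNReal.toReal_ofReal hp'.le]; exact (hφe j).1)
      (by rw [ENNReal.toReal_ofReal (hpn' _).le, ENNReal.toReal_ofReal hp'.le]
          exact le_two j (hpn' _) hp' (hφe j).2))
    (fun j => homHolder_mazurMap (toReal_pos hp) (toReal_pos (hpn (φ j))) (expo_nonneg j)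
      (expo_lt_one j).le
      (by rw [ENNReal.toReal_ofReal (hpn' _).le, ENNReal.toReal_ofReal hp'.le]; exact (hφe j).2)
      (by rw [ENNReal.toReal_ofReal (hpn' _).le, ENNReal.toReal_ofReal hp'.le]
          exact le_two j hp' (hpn' _) (hφe j).1))
  obtain ⟨V, ⟨L⟩⟩ := exists_continuousLinearEquiv_subseq
    (X := fun n : ℕ => lp (fun _ : ℕ => ℝ) (ENNReal.ofReal (pn n))) (q := ENNReal.ofReal q)
    (toReal_pos hq) hφ
  let U : lp _ _ ≃ᵤ _ :=
    { L.toEquiv with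
      uniformContinuous_toFun := L.toContinuousLinearMap.uniformContinuous
      uniformContinuous_invFun := L.symm.toContinuousLinearMap.uniformContinuous }
  let f := (WithLp.uniformEquivProd (ENNReal.ofReal q) _ _).trans <|
    ((UniformEquiv.refl _).prodCongr U).trans <| (UniformEquiv.prodAssoc _ _ _).symm.trans <|
      (e.prodCongr (UniformEquiv.refl V)).trans U.symm
  exact ⟨f.toEquiv, f.uniformContinuous, f.symm.uniformContinuous⟩
end
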